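/- arXiv:math/9711208 — 2 statements merged into one kernel-verified Lean document; each statement's English description precedes it below -/
import Mathlib

section
/- Let Ω ⊆ ℝⁿ be a nonempty open convex set. Then the group of surjective linear isometries of C₀(Ω) is algebraically reflexive: every bounded linear map F on C₀(Ω) such that for each f ∈ C₀(Ω) there exists a surjective linear isometry F_f of C₀(Ω) with F(f) = F_f(f), is itself a surjective linear isometry of C₀(Ω). -/
open scoped ZeroAtInfty

/-- A surjective linear isometry of a normed space onto itself. -/
def IsSurjectiveLinearIsometry {A : Type*} [SeminormedAddCommGroup A] [Module ℂ A]
    (Φ : A → A) : Prop :=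
  IsLinearMap ℂ Φ ∧ Function.Surjective Φ ∧ ∀ a : A, ‖Φ a‖ = ‖a‖

open scoped ZeroAtInfty Topology
open Filter

section GeneralSpace

theorem c0_norm_apply_le {X : Type*} [TopologicalSpace X] (f : C₀(X, ℂ)) (x : X) :
    ‖f x‖ ≤ ‖f‖ := by
  rw [← ZeroAtInftyContinuousMap.norm_toBCF_eq_norm]
  exact f.toBCF.norm_coe_le_norm x

theorem c0_norm_le {X : Type*} [TopologicalSpace X] (f : C₀(X, ℂ)) {C : ℝ} (hC : 0 ≤ C)
    (h : ∀ x, ‖f x‖ ≤ C) : ‖f‖ ≤ C := by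
  rw [← ZeroAtInftyContinuousMap.norm_toBCF_eq_norm]
  exact (BoundedContinuousFunction.norm_le hC).2 h

theorem c0_compact {X : Type*} [TopologicalSpace X] (f : C₀(X, ℂ)) {ε : ℝ} (hε : 0 < ε) :
    IsCompact {x | ε ≤ ‖f x‖} := by
  have h : Tendsto (fun x => ‖f x‖) (cocompact X) (𝓝 0) := by
    simpa using (zero_at_infty f).norm
  have h2 := h (Iio_mem_nhds hε)
  obtain ⟨K, hK, hKs⟩ := Filter.mem_cocompact.1 h2
  refine hK.of_isClosed_subset (isClosed_le continuous_const (map_continuous f).norm) ?_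
  intro x hx
  by_contra hxK
  have := hKs hxK
  simp only [Set.mem_preimage, Set.mem_Iio, Set.mem_ofPred_eq] at this hx
  linarith

theorem c0_attain {X : Type*} [TopologicalSpace X] (f : C₀(X, ℂ)) (hf : ‖f‖ = 1) :
    ∃ x, ‖f x‖ = 1 := by
  have hK := c0_compact f (ε := 1 / 2) (by norm_num)
  rcases Set.eq_empty_or_nonempty {x | (1 / 2 : ℝ) ≤ ‖f x‖} with he | hne
  · exfalso
    have : ‖f‖ ≤ 1 / 2 := c0_norm_le f (by norm_num) (fun x => by
      by_contra hx
      have : x ∈ {x | (1 / 2 : ℝ) ≤ ‖f x‖} := (not_le.1 hx).le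
      rw [he] at this
      exact this)
    linarith
  · obtain ⟨x, hx, hmax⟩ := hK.exists_isMaxOn hne (map_continuous f).norm.continuousOn
    refine ⟨x, le_antisymm (hf ▸ c0_norm_apply_le f x) ?_⟩
    rw [← hf]
    refine c0_norm_le f (norm_nonneg _) fun y => ?_
    by_cases hy : (1 / 2 : ℝ) ≤ ‖f y‖
    · exact hmax hy
    · exact (not_le.1 hy).le.trans hx

theorem c0_mk_compact {X : Type*} [TopologicalSpace X] (q : X → ℂ) (hq : Continuous q)
    {K : Set X} (hK : IsCompact K) (h0 : ∀ x, x ∉ K → q x = 0) :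
    ∃ f : C₀(X, ℂ), ∀ x, f x = q x := by
  refine ⟨⟨⟨q, hq⟩, ?_⟩, fun x => rfl⟩
  refine tendsto_const_nhds.congr' ?_
  filter_upwards [hK.compl_mem_cocompact] with x hx
  exact (h0 x hx).symm

theorem c0_peak {X : Type*} [MetricSpace X] [LocallyCompactSpace X] (x : X) {U : Set X}
    (hU : U ∈ 𝓝 x) : ∃ (f : C₀(X, ℂ)) (q : X → ℝ), (∀ y, f y = (q y : ℂ)) ∧
      (∀ y, 0 ≤ q y) ∧ (∀ y, q y ≤ 1) ∧ (∀ y, q y = 1 ↔ y = x) ∧ (∀ y, q y ≠ 0 → y ∈ U) := by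
  obtain ⟨K, hKx, hKU, hK⟩ := local_compact_nhds hU
  obtain ⟨r, hr, hrK⟩ := Metric.mem_nhds_iff.1 hKx
  have h0 : ∀ y, y ∉ K → max 0 (1 - dist y x / r) = 0 := by
    intro y hy
    have : ¬ dist y x < r := fun h => hy (hrK h)
    rw [max_eq_left]
    rw [sub_nonpos, one_le_div hr]
    exact not_lt.1 this
  obtain ⟨f, hf⟩ := c0_mk_compact (fun y => ((max 0 (1 - dist y x / r) : ℝ) : ℂ))
    (by fun_prop) hK (fun y hy => by rw [h0 y hy]; simp)
  refine ⟨f, _, hf, fun y => le_max_left _ _, fun y => ?_, fun y => ?_, fun y hy => ?_⟩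
  · have : 0 ≤ dist y x / r := by positivity
    exact max_le zero_le_one (by linarith)
  · constructor
    · intro h
      rcases max_choice 0 (1 - dist y x / r) with h' | h'
      · rw [h'] at h; norm_num at h
      · rw [h'] at h
        have : dist y x / r = 0 := by linarith
        rcases div_eq_zero_iff.1 this with h2 | h2
        · exact dist_eq_zero.1 h2
        · exact absurd h2 hr.ne'
    · rintro rfl; simp
  · by_contra hyU
    exact hy (h0 y fun h => hyU (hKU h))

theorem c0_sep {X : Type*} [MetricSpace X] [LocallyCompactSpace X] {x y : X}
    (h : ∀ f : C₀(X, ℂ), ‖f x‖ = ‖f y‖) : x = y := by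
  obtain ⟨f, q, hf, h0, h1, hq, -⟩ := c0_peak y (U := Set.univ) univ_mem
  have := h f
  rw [hf, hf, Complex.norm_real, Complex.norm_real, Real.norm_of_nonneg (h0 _),
    Real.norm_of_nonneg (h0 _), (hq y).2 rfl] at this
  exact (hq x).1 this

theorem c0_continuous_of {X : Type*} [MetricSpace X] [LocallyCompactSpace X] (φ : X → X)
    (T : C₀(X, ℂ) → C₀(X, ℂ)) (h : ∀ f y, ‖T f y‖ = ‖f (φ y)‖) : Continuous φ := by
  rw [continuous_iff_continuousAt]
  intro y U hU
  obtain ⟨f, q, hf, h0, h1, hq, hs⟩ := c0_peak (φ y) hU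
  have hy : T f y ≠ 0 := by
    rw [← norm_ne_zero_iff, h, hf, (hq _).2 rfl]; simp
  have : ∀ᶠ z in 𝓝 y, T f z ≠ 0 := (map_continuous (T f)).continuousAt.eventually_ne hy
  rw [Filter.mem_map]
  filter_upwards [this] with z hz
  apply hs
  rw [← norm_ne_zero_iff, h, hf] at hz
  intro h'
  simp [h'] at hz

theorem complex_midpoint {a b : ℂ} (ha : ‖a‖ ≤ 1) (hb : ‖b‖ ≤ 1)
    (h : ‖(1 / 2 : ℂ) * (a + b)‖ = 1) : a = b ∧ ‖a‖ = 1 ∧ ‖b‖ = 1 := by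
  have h2 : ‖a + b‖ = 2 := by
    rw [norm_mul] at h
    norm_num at h
    linarith
  have hp := parallelogram_law_with_norm_mul ℝ a b
  have hn := norm_nonneg (a - b)
  have hna := norm_nonneg a
  have hnb := norm_nonneg b
  rw [h2] at hp
  have h3 : ‖a - b‖ = 0 := by nlinarith
  have h4 : a = b := by
    rw [norm_eq_zero] at h3; exact sub_eq_zero.1 h3
  have := norm_add_le a b
  exact ⟨h4, by linarith, by linarith⟩

theorem c0_holsztynski {X : Type*} [MetricSpace X] [LocallyCompactSpace X]
    (T : C₀(X, ℂ) →ₗ[ℂ] C₀(X, ℂ)) (hT : ∀ f, ‖T f‖ = ‖f‖) (x : X) :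
    ∃ y, ∀ f, ‖T f y‖ = ‖f x‖ := by
  obtain ⟨e, qe, hqe, he0, he1, heq, -⟩ := c0_peak x (U := Set.univ) univ_mem
  have hex : e x = 1 := by rw [hqe, (heq x).2 rfl]; simp
  have hen : ‖e‖ ≤ 1 := c0_norm_le e zero_le_one fun y => by
    rw [hqe, Complex.norm_real, Real.norm_of_nonneg (he0 _)]; exact he1 y
  let ι := {f : C₀(X, ℂ) // ‖f‖ ≤ 1 ∧ f x = 1}
  have hnorm : ∀ f : ι, ‖f.1‖ = 1 := fun f => le_antisymm f.2.1 (by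
    have := c0_norm_apply_le f.1 x
    rw [f.2.2] at this; simpa using this)
  have hle : ∀ (f : ι) y, ‖T f.1 y‖ ≤ 1 := fun f y => by
    have := c0_norm_apply_le (T f.1) y
    rwa [hT, hnorm] at this
  let mid : ι → ι → ι := fun f g => ⟨(1 / 2 : ℂ) • (f.1 + g.1), by
    constructor
    · rw [norm_smul]
      have := norm_add_le f.1 g.1
      have h1 := f.2.1
      have h2 := g.2.1
      norm_num
      linarith
    · have h1 := f.2.2
      have h2 := g.2.2
      simp only [ZeroAtInftyContinuousMap.smul_apply, ZeroAtInftyContinuousMap.add_apply, h1, h2]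
      norm_num⟩
  have hmid : ∀ (f g : ι) y, T (mid f g).1 y = (1 / 2 : ℂ) * (T f.1 y + T g.1 y) := by
    intro f g y
    simp only [mid, map_smul, map_add, ZeroAtInftyContinuousMap.smul_apply,
      ZeroAtInftyContinuousMap.add_apply, smul_eq_mul]
  let M : ι → Set X := fun f => {y | 1 ≤ ‖T f.1 y‖}
  have hmidM : ∀ (f g : ι) y, y ∈ M (mid f g) → T f.1 y = T g.1 y ∧ y ∈ M f ∧ y ∈ M g := by
    intro f g y hy
    have h1 : ‖T (mid f g).1 y‖ = 1 := le_antisymm (hle _ _) hy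
    rw [hmid] at h1
    obtain ⟨ha, hb, hc⟩ := complex_midpoint (hle f y) (hle g y) h1
    exact ⟨ha, hb.ge, hc.ge⟩
  have : Nonempty ι := ⟨⟨e, hen, hex⟩⟩
  have hne : (⋂ f, M f).Nonempty := by
    refine IsCompact.nonempty_iInter_of_directed_nonempty_isCompact_isClosed M ?_ ?_ ?_ ?_
    · intro f g
      exact ⟨mid f g, fun y hy => (hmidM f g y hy).2.1, fun y hy => (hmidM f g y hy).2.2⟩
    · intro f
      obtain ⟨y, hy⟩ := c0_attain (T f.1) (by rw [hT, hnorm])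
      exact ⟨y, hy.ge⟩
    · intro f
      exact c0_compact (T f.1) one_pos
    · intro f
      exact (c0_compact (T f.1) one_pos).isClosed
  obtain ⟨y, hy⟩ := hne
  rw [Set.mem_iInter] at hy
  have hconst : ∀ f : ι, T f.1 y = T e y := fun f => (hmidM f ⟨e, hen, hex⟩ y (hy _)).1
  have hTe : ‖T e y‖ = 1 := le_antisymm (hle ⟨e, hen, hex⟩ y) (hy ⟨e, hen, hex⟩)
  have hvan1 : ∀ f : C₀(X, ℂ), ‖f‖ ≤ 1 → f x = 0 → T f y = 0 := by
    intro f hf hfx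
    rw [← norm_le_zero_iff]
    refine le_of_forall_pos_le_add fun ε hε => ?_
    rw [zero_add]
    have hU : {z | ‖f z‖ < ε} ∈ 𝓝 x := by
      refine (isOpen_lt (map_continuous f).norm continuous_const).mem_nhds ?_
      simp [hfx, hε]
    obtain ⟨p, q, hp, hp0, hp1, hpq, hps⟩ := c0_peak x hU
    have hpx : p x = 1 := by rw [hp, (hpq x).2 rfl]; simp
    have hpn : ‖p‖ ≤ 1 := c0_norm_le p zero_le_one fun y => by
      rw [hp, Complex.norm_real, Real.norm_of_nonneg (hp0 _)]; exact hp1 y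
    have h1 := hconst ⟨p, hpn, hpx⟩
    have h2 := hconst ⟨p + (f - p * f), by
      refine c0_norm_le _ zero_le_one fun z => ?_
      have hz : (p + (f - p * f)) z = (q z : ℂ) + ((1 - q z : ℝ) : ℂ) * f z := by
        simp [hp]; ring
      rw [hz]
      refine (norm_add_le _ _).trans ?_
      have h1 : 0 ≤ 1 - q z := by linarith [hp1 z]
      rw [norm_mul, Complex.norm_real, Complex.norm_real, Real.norm_of_nonneg (hp0 z),
        Real.norm_of_nonneg h1]
      have h3 := (c0_norm_apply_le f z).trans hf
      nlinarith, by simp [hpx]⟩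
    simp only [map_add, ZeroAtInftyContinuousMap.add_apply] at h2
    simp only at h1
    rw [h1] at h2
    have h3 : T (f - p * f) y = 0 := by simpa using h2
    have h4 : T f y = T (p * f) y := by
      rw [map_sub, ZeroAtInftyContinuousMap.sub_apply] at h3
      exact sub_eq_zero.1 h3
    rw [h4]
    refine (c0_norm_apply_le _ _).trans ?_
    rw [hT]
    refine c0_norm_le _ hε.le fun z => ?_
    rw [ZeroAtInftyContinuousMap.mul_apply, hp, norm_mul, Complex.norm_real,
      Real.norm_of_nonneg (hp0 z)]
    by_cases hz : q z = 0
    · rw [hz, zero_mul]; exact hε.le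
    · have h5 : ‖f z‖ < ε := hps z hz
      nlinarith [hp0 z, hp1 z, norm_nonneg (f z)]
  have hvan : ∀ f : C₀(X, ℂ), f x = 0 → T f y = 0 := by
    intro f hfx
    have hpos : (0 : ℝ) < ‖f‖ + 1 := by positivity
    have h1 := hvan1 ((((‖f‖ + 1)⁻¹ : ℝ) : ℂ) • f) (by
      rw [norm_smul, Complex.norm_real, Real.norm_of_nonneg (by positivity),
        inv_mul_le_iff₀ hpos]; linarith) (by simp [hfx])
    rw [map_smul, ZeroAtInftyContinuousMap.smul_apply, smul_eq_zero] at h1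
    rcases h1 with h1 | h1
    · exfalso
      have : (‖f‖ + 1)⁻¹ = 0 := by exact_mod_cast h1
      exact (inv_pos.2 hpos).ne' this
    · exact h1
  refine ⟨y, fun f => ?_⟩
  have h1 := hvan (f - f x • e) (by simp [hex])
  rw [map_sub, map_smul, ZeroAtInftyContinuousMap.sub_apply, ZeroAtInftyContinuousMap.smul_apply,
    sub_eq_zero] at h1
  rw [h1, norm_smul, hTe, mul_one]

theorem c0_banach_stone {X : Type*} [MetricSpace X] [LocallyCompactSpace X]
    (S : C₀(X, ℂ) → C₀(X, ℂ)) (hlin : IsLinearMap ℂ S) (hsurj : Function.Surjective S)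
    (hn : ∀ f, ‖S f‖ = ‖f‖) :
    ∃ φ : X ≃ₜ X, ∀ f y, ‖S f y‖ = ‖f (φ y)‖ := by
  let T : C₀(X, ℂ) →ₗ[ℂ] C₀(X, ℂ) := hlin.mk' S
  have hTS : ∀ f, T f = S f := fun f => rfl
  have hinj : Function.Injective T := by
    rw [injective_iff_map_eq_zero]
    intro f hf
    rw [← norm_eq_zero, ← hn, ← hTS, hf, norm_zero]
  let e := LinearEquiv.ofBijective T ⟨hinj, hsurj⟩
  have he : ∀ f, e f = S f := fun f => rfl
  have hes : ∀ f, ‖e.symm.toLinearMap f‖ = ‖f‖ := fun f => by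
    have : S (e.symm f) = f := by rw [← he, e.apply_symm_apply]
    conv_rhs => rw [← this, hn]
    rfl
  choose ψ hψ using c0_holsztynski T hn
  choose φ hφ using c0_holsztynski e.symm.toLinearMap hes
  have hφ' : ∀ f y, ‖S f y‖ = ‖f (φ y)‖ := fun f y => by
    rw [← hφ y (S f)]
    have : e.symm.toLinearMap (S f) = f := by
      rw [← he]; exact e.symm_apply_apply f
    rw [this]
  have hψ' : ∀ f x, ‖e.symm f x‖ = ‖f (ψ x)‖ := fun f x => by
    rw [← hψ x (e.symm f)]
    have : T (e.symm f) = f := e.apply_symm_apply f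
    rw [this]
  refine ⟨⟨⟨φ, ψ, fun y => ?_, fun y => ?_⟩, ?_, ?_⟩, hφ'⟩
  · refine c0_sep fun f => ?_
    rw [← hψ', ← hφ y]; rfl
  · refine c0_sep fun f => ?_
    rw [← hφ', ← hψ y]; rfl
  · exact c0_continuous_of φ S hφ'
  · exact c0_continuous_of ψ (fun f => e.symm f) hψ'

open BoundedContinuousFunction in
theorem bcf_gkz {X : Type*} [TopologicalSpace X] {m : ℕ} (k : Fin m → X → ℝ)
    (hk : ∀ i, Continuous (k i)) (hinj : ∀ x y, (∀ i, k i x = k i y) → x = y)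
    (M : BoundedContinuousFunction X ℂ → ℂ)
    (hadd : ∀ g h, M (g + h) = M g + M h) (hsmul : ∀ (c : ℂ) h, M (c • h) = c * M h)
    (hM : ∀ h, ∃ x, M h = h x) : ∃ x, ∀ h, M h = h x := by
  let C : BoundedContinuousFunction X ℝ → BoundedContinuousFunction X ℂ := fun u =>
    BoundedContinuousFunction.ofNormedAddCommGroup (fun x => (u x : ℂ)) (by fun_prop) ‖u‖
      (fun x => by rw [Complex.norm_real]; exact u.norm_coe_le_norm x)
  have hC : ∀ u x, C u x = (u x : ℂ) := fun u x => rfl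
  have hCadd : ∀ u v, C (u + v) = C u + C v := fun u v => by ext x; simp [hC]
  have hCsmul : ∀ (c : ℝ) u, C (c • u) = (c : ℂ) • C u := fun c u => by ext x; simp [hC]
  let R : BoundedContinuousFunction X ℝ → ℝ := fun u => (M (C u)).re
  have hR : ∀ u, M (C u) = (R u : ℂ) := by
    intro u
    obtain ⟨x, hx⟩ := hM (C u)
    rw [hC] at hx
    simp only [R, hx, Complex.ofReal_re]
  have hRadd : ∀ u v, R (u + v) = R u + R v := fun u v => by
    simp only [R, hCadd, hadd, Complex.add_re]
  have hRsmul : ∀ (c : ℝ) u, R (c • u) = c * R u := fun c u => by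
    simp only [R, hCsmul, hsmul, Complex.re_ofReal_mul]
  have hRuv : ∀ u v, ∃ x, R u = u x ∧ R v = v x := by
    intro u v
    obtain ⟨x, hx⟩ := hM (C u + Complex.I • C v)
    rw [hadd, hsmul, hR, hR] at hx
    simp only [BoundedContinuousFunction.add_apply, BoundedContinuousFunction.smul_apply, hC,
      smul_eq_mul] at hx
    refine ⟨x, ?_, ?_⟩
    · simpa using congrArg Complex.re hx
    · simpa using congrArg Complex.im hx
  have hRsq : ∀ u, R (u * u) = R u * R u := fun u => by
    obtain ⟨x, h1, h2⟩ := hRuv u (u * u)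
    rw [h2, h1]; rfl
  have hR1 : R 1 = 1 := by
    obtain ⟨x, h1, -⟩ := hRuv 1 1
    rw [h1]; rfl
  have hR0 : R 0 = 0 := by
    obtain ⟨x, h1, -⟩ := hRuv 0 0
    rw [h1]; rfl
  let Z : BoundedContinuousFunction X ℝ → BoundedContinuousFunction X ℝ := fun u =>
    (u + (-R u) • 1) * (u + (-R u) • 1)
  have hZ : ∀ u, R (Z u) = 0 := fun u => by
    simp only [Z]
    rw [hRsq, hRadd, hRsmul, hR1]; ring
  have hZx : ∀ u x, Z u x = (u x - R u) ^ 2 := fun u x => by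
    simp [Z]; ring
  let a : Fin m → BoundedContinuousFunction X ℝ := fun i =>
    BoundedContinuousFunction.ofNormedAddCommGroup (fun x => Real.arctan (k i x))
      (Real.continuous_arctan.comp (hk i)) (Real.pi / 2)
      (fun x => by
        rw [Real.norm_eq_abs, abs_le]
        exact ⟨(Real.neg_pi_div_two_lt_arctan _).le, (Real.arctan_lt_pi_div_two _).le⟩)
  have hsum : ∀ s : Finset (Fin m), R (∑ i ∈ s, Z (a i)) = 0 := by
    intro s
    induction s using Finset.induction_on with
    | empty => simpa using hR0
    | insert i s hi ih => rw [Finset.sum_insert hi, hRadd, hZ, ih, add_zero]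
  have key : ∀ u, ∃ x, u x = R u ∧ ∀ i, a i x = R (a i) := by
    intro u
    obtain ⟨x, hx, -⟩ := hRuv (Z u + ∑ i, Z (a i)) 0
    rw [hRadd, hsum, hZ, add_zero, BoundedContinuousFunction.add_apply,
      BoundedContinuousFunction.sum_apply, hZx] at hx
    have hnn : 0 ≤ ∑ i, Z (a i) x := Finset.sum_nonneg fun i _ => by rw [hZx]; positivity
    have h1 : (u x - R u) ^ 2 = 0 := by nlinarith [sq_nonneg (u x - R u)]
    have h2 : ∑ i, Z (a i) x = 0 := by nlinarith [sq_nonneg (u x - R u)]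
    refine ⟨x, ?_, fun i => ?_⟩
    · have := pow_eq_zero_iff (two_ne_zero) |>.1 h1
      linarith
    · have h3 := (Finset.sum_eq_zero_iff_of_nonneg
        (fun i _ => by rw [hZx]; positivity)).1 h2 i (Finset.mem_univ i)
      rw [hZx] at h3
      have := pow_eq_zero_iff (two_ne_zero) |>.1 h3
      linarith
  obtain ⟨x, -, hx⟩ := key 0
  have hRx : ∀ u, R u = u x := by
    intro u
    obtain ⟨y, hy, hy2⟩ := key u
    have : y = x := hinj y x fun i => Real.arctan_injective ((hy2 i).trans (hx i).symm)
    rw [← hy, this]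
  refine ⟨x, fun h => ?_⟩
  let u : BoundedContinuousFunction X ℝ :=
    BoundedContinuousFunction.ofNormedAddCommGroup (fun x => (h x).re) (by fun_prop) ‖h‖
      (fun x => (Complex.abs_re_le_norm _).trans (h.norm_coe_le_norm x))
  let v : BoundedContinuousFunction X ℝ :=
    BoundedContinuousFunction.ofNormedAddCommGroup (fun x => (h x).im) (by fun_prop) ‖h‖
      (fun x => (Complex.abs_im_le_norm _).trans (h.norm_coe_le_norm x))
  have hh : h = C u + Complex.I • C v := by
    ext y
    simp only [BoundedContinuousFunction.add_apply, BoundedContinuousFunction.smul_apply, hC,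
      smul_eq_mul]
    rw [mul_comm]
    exact (Complex.re_add_im (h y)).symm
  conv_lhs => rw [hh]
  rw [hadd, hsmul, hR, hR, hRx, hRx, mul_comm]
  exact Complex.re_add_im (h x)

/-- product of a function vanishing at infinity and a bounded continuous function -/
noncomputable def c0MulB {X : Type*} [TopologicalSpace X] (G : C₀(X, ℂ))
    (h : BoundedContinuousFunction X ℂ) : C₀(X, ℂ) :=
  ⟨⟨fun x => G x * h x, (map_continuous G).mul h.continuous⟩, by
    have h1 : Tendsto (fun x => ‖G x‖ * ‖h‖) (cocompact X) (𝓝 0) := by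
      simpa using (zero_at_infty G).norm.mul_const ‖h‖
    refine squeeze_zero_norm (fun x => ?_) h1
    change ‖G x * h x‖ ≤ _
    rw [norm_mul]
    exact mul_le_mul_of_nonneg_left (h.norm_coe_le_norm x) (norm_nonneg _)⟩

theorem c0MulB_apply {X : Type*} [TopologicalSpace X] (G : C₀(X, ℂ))
    (h : BoundedContinuousFunction X ℂ) (x : X) : c0MulB G h x = G x * h x := rfl

theorem c0_gkz_aux {X : Type*} [TopologicalSpace X] {m : ℕ} (k : Fin m → X → ℝ)
    (hk : ∀ i, Continuous (k i)) (hinj : ∀ x y, (∀ i, k i x = k i y) → x = y)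
    (L : C₀(X, ℂ) →ₗ[ℂ] ℂ) (hL : ∀ f, L f = 0 → ∃ x, f x = 0)
    (G : C₀(X, ℂ)) (hG : ∀ x, G x ≠ 0) :
    L G ≠ 0 ∧ ∃ x, ∀ h, L (c0MulB G h) = L G * h x := by
  have hLG : L G ≠ 0 := fun h => by
    obtain ⟨x, hx⟩ := hL G h
    exact hG x hx
  refine ⟨hLG, ?_⟩
  have hadd : ∀ g h, L (c0MulB G (g + h)) / L G = L (c0MulB G g) / L G + L (c0MulB G h) / L G := by
    intro g h
    have : c0MulB G (g + h) = c0MulB G g + c0MulB G h := by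
      ext x; simp [c0MulB_apply, mul_add]
    simp only [this, map_add, add_div]
  have hsmul : ∀ (c : ℂ) h, L (c0MulB G (c • h)) / L G = c * (L (c0MulB G h) / L G) := by
    intro c h
    have : c0MulB G (c • h) = c • c0MulB G h := by
      ext x; simp [c0MulB_apply]; ring
    simp only [this, map_smul, smul_eq_mul, mul_div_assoc]
  have hrange : ∀ h, ∃ x, L (c0MulB G h) / L G = h x := by
    intro h
    obtain ⟨x, hx⟩ := hL (c0MulB G h - (L (c0MulB G h) / L G) • G) (by
      rw [map_sub, map_smul, smul_eq_mul, div_mul_cancel₀ _ hLG, sub_self])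
    refine ⟨x, ?_⟩
    rw [ZeroAtInftyContinuousMap.sub_apply, ZeroAtInftyContinuousMap.smul_apply, c0MulB_apply,
      smul_eq_mul, sub_eq_zero, mul_comm (G x)] at hx
    exact (mul_right_cancel₀ (hG x) hx).symm
  obtain ⟨x, hx⟩ := bcf_gkz k hk hinj (fun h => L (c0MulB G h) / L G) hadd hsmul hrange
  refine ⟨x, fun h => ?_⟩
  rw [← hx h, mul_div_cancel₀ _ hLG]

theorem c0_gkz {X : Type*} [TopologicalSpace X] {m : ℕ} (k : Fin m → X → ℝ)
    (hk : ∀ i, Continuous (k i)) (hinj : ∀ x y, (∀ i, k i x = k i y) → x = y)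
    (g : C₀(X, ℂ)) (q : X → ℝ) (hgq : ∀ x, g x = (q x : ℂ)) (hq : ∀ x, 0 < q x)
    (L : C₀(X, ℂ) →ₗ[ℂ] ℂ) (hL : ∀ f, L f = 0 → ∃ x, f x = 0) :
    ∃ (x : X) (c : ℂ), c ≠ 0 ∧ ∀ f, L f = c * f x := by
  have hqc : Continuous q := by
    have : q = fun x => (g x).re := by ext x; simp [hgq]
    rw [this]; fun_prop
  have hg0 : ∀ x, g x ≠ 0 := fun x => by
    rw [hgq]; exact_mod_cast (hq x).ne'
  obtain ⟨hLg, x, hx⟩ := c0_gkz_aux k hk hinj L hL g hg0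
  refine ⟨x, L g / g x, div_ne_zero hLg (hg0 x), fun f => ?_⟩
  let G : C₀(X, ℂ) := ⟨⟨fun y => ((‖f y‖ + q y : ℝ) : ℂ), by fun_prop⟩, by
    have h1 : Tendsto (fun x => ((‖f x‖ : ℝ) : ℂ) + g x) (cocompact X) (𝓝 0) := by
      simpa using ((Complex.continuous_ofReal.tendsto 0).comp
        (by simpa using (zero_at_infty f).norm)).add (zero_at_infty g)
    refine h1.congr fun x => ?_
    rw [hgq]
    change _ = ((‖f x‖ + q x : ℝ) : ℂ)
    push_cast
    rfl⟩
  have hGx : ∀ y, G y = ((‖f y‖ + q y : ℝ) : ℂ) := fun y => rfl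
  have hpos : ∀ y, 0 < ‖f y‖ + q y := fun y => by have := hq y; positivity
  have hG0 : ∀ y, G y ≠ 0 := fun y => by
    rw [hGx]; exact_mod_cast (hpos y).ne'
  have hGn : ∀ y, ‖G y‖ = ‖f y‖ + q y := fun y => by
    rw [hGx, Complex.norm_real, Real.norm_of_nonneg (hpos y).le]
  obtain ⟨hLG, z, hz⟩ := c0_gkz_aux k hk hinj L hL G hG0
  let hf : BoundedContinuousFunction X ℂ := BoundedContinuousFunction.ofNormedAddCommGroup
    (fun y => f y / G y) ((map_continuous f).div (map_continuous G) hG0) 1 (fun y => by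
      rw [norm_div, hGn, div_le_one (hpos y)]; linarith [hq y])
  let hg : BoundedContinuousFunction X ℂ := BoundedContinuousFunction.ofNormedAddCommGroup
    (fun y => g y / G y) ((map_continuous g).div (map_continuous G) hG0) 1 (fun y => by
      rw [norm_div, hGn, div_le_one (hpos y), hgq, Complex.norm_real,
        Real.norm_of_nonneg (hq y).le]; linarith [norm_nonneg (f y)])
  have e1 : c0MulB G hf = f := by
    ext y
    rw [c0MulB_apply]
    exact mul_div_cancel₀ (f y) (hG0 y)
  have e2 : c0MulB G hg = g := by
    ext y
    rw [c0MulB_apply]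
    exact mul_div_cancel₀ (g y) (hG0 y)
  have e3 : L f = L G * (f z / G z) := by
    have := hz hf
    rwa [e1] at this
  have e4 : L g = L G * (g z / G z) := by
    have := hz hg
    rwa [e2] at this
  have hxz : x = z := by
    refine hinj x z fun i => Real.arctan_injective ?_
    let a : BoundedContinuousFunction X ℂ := BoundedContinuousFunction.ofNormedAddCommGroup
      (fun x => (Real.arctan (k i x) : ℂ))
      (Complex.continuous_ofReal.comp (Real.continuous_arctan.comp (hk i))) (Real.pi / 2)
      (fun x => by
        rw [Complex.norm_real, Real.norm_eq_abs, abs_le]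
        exact ⟨(Real.neg_pi_div_two_lt_arctan _).le, (Real.arctan_lt_pi_div_two _).le⟩)
    have h1 := hx a
    have h2 : c0MulB g a = c0MulB G (hg * a) := by
      ext y
      rw [c0MulB_apply, c0MulB_apply, BoundedContinuousFunction.mul_apply, ← mul_assoc]
      congr 1
      exact (mul_div_cancel₀ (g y) (hG0 y)).symm
    rw [h2, hz, BoundedContinuousFunction.mul_apply, ← mul_assoc] at h1
    have h3 : L G * hg z = L g := e4.symm
    rw [h3] at h1
    have h4 := mul_left_cancel₀ hLg h1
    have h5 : ((Real.arctan (k i z) : ℝ) : ℂ) = ((Real.arctan (k i x) : ℝ) : ℂ) := h4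
    exact_mod_cast h5.symm
  rw [e4, e3, ← hxz]
  have := hG0 x
  have := hg0 x
  field_simp

theorem c0_general {X : Type*} [MetricSpace X] [LocallyCompactSpace X]
    [SecondCountableTopology X] {m : ℕ} (k : Fin m → X → ℝ)
    (hk : ∀ i, Continuous (k i)) (hinj : ∀ x y, (∀ i, k i x = k i y) → x = y)
    (g : C₀(X, ℂ)) (gq : X → ℝ) (hgq : ∀ x, g x = (gq x : ℂ)) (hgpos : ∀ x, 0 < gq x)
    (hP : ∀ x : X, ∃ (q : X → ℝ) (K : Set X), Continuous q ∧ (∀ y, 0 ≤ q y) ∧ 0 < q x ∧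
      IsCompact K ∧ (∀ y, y ∉ K → q y = 0) ∧ Dense {z | ∀ᶠ y in 𝓝 z, q y = q z})
    (F : C₀(X, ℂ) →ₗ[ℂ] C₀(X, ℂ))
    (hF : ∀ f, ∃ φ : X ≃ₜ X, ∀ y, ‖F f y‖ = ‖f (φ y)‖) : Function.Surjective F := by
  have hg0 : ∀ x, g x ≠ 0 := fun x => by
    rw [hgq]; exact_mod_cast (hgpos x).ne'
  have h1 : ∀ y, ∃ (x : X) (c : ℂ), c ≠ 0 ∧ ∀ f, F f y = c * f x := by
    intro y
    let L : C₀(X, ℂ) →ₗ[ℂ] ℂ :=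
      { toFun := fun f => F f y
        map_add' := fun f g => by simp
        map_smul' := fun c f => by simp }
    refine c0_gkz k hk hinj g gq hgq hgpos L fun f hf => ?_
    obtain ⟨φ, hφ⟩ := hF f
    refine ⟨φ y, ?_⟩
    rw [← norm_eq_zero, ← hφ]
    have : F f y = 0 := hf
    rw [this, norm_zero]
  choose ψ c hc0 hFc using h1
  have hcle : ∀ y, ‖c y‖ ≤ 1 := by
    intro y
    obtain ⟨p, q, hp, hp0, hp1, hpq, -⟩ := c0_peak (ψ y) (U := Set.univ) univ_mem
    obtain ⟨φ, hφ⟩ := hF p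
    have h2 := hφ y
    rw [hFc, hp, hp, (hpq _).2 rfl, Complex.norm_real, Real.norm_of_nonneg (hp0 _)] at h2
    simp only [Complex.ofReal_one, mul_one] at h2
    rw [h2]
    exact hp1 _
  have hc1 : ∀ y, ‖c y‖ = 1 := by
    intro y0
    by_contra hne
    have hlt : ‖c y0‖ < 1 := lt_of_le_of_ne (hcle y0) hne
    obtain ⟨q, K, hqc, hq0, hqpos, hK, hqK, hD⟩ := hP (ψ y0)
    set D := {z | ∀ᶠ y in 𝓝 z, q y = q z} with hDdef
    have hDo : IsOpen D := by
      rw [isOpen_iff_mem_nhds]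
      intro z hz
      have hz' : ∀ᶠ y in 𝓝 z, q y = q z := hz
      filter_upwards [hz'.eventually_nhds, hz'] with w hw hw2
      change ∀ᶠ y in 𝓝 w, q y = q w
      filter_upwards [hw] with v hv
      rw [hv, hw2]
    have hpow : ∀ a : ℝ, 0 < a → ∃ f : C₀(X, ℂ), ∀ x, f x = ((q x ^ a : ℝ) : ℂ) := by
      intro a ha
      refine c0_mk_compact _ ?_ hK ?_
      · exact Complex.continuous_ofReal.comp (hqc.rpow_const fun x => Or.inr ha.le)
      · intro x hx
        rw [hqK x hx, Real.zero_rpow ha.ne']; simp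
    have hpow2 : ∀ a : ℝ, 0 < a → ∃ (A : X → ℝ) (φ : X ≃ₜ X), Continuous A ∧
        (∀ y, A y = ‖c y‖ * q (ψ y) ^ a) ∧ ∀ y, A y = q (φ y) ^ a := by
      intro a ha
      obtain ⟨f, hf⟩ := hpow a ha
      obtain ⟨φ, hφ⟩ := hF f
      refine ⟨fun y => ‖F f y‖, φ, (map_continuous (F f)).norm, fun y => ?_, fun y => ?_⟩
      · simp only
        rw [hFc, norm_mul, hf, Complex.norm_real,
          Real.norm_of_nonneg (Real.rpow_nonneg (hq0 _) _)]
      · simp only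
        rw [hφ, hf, Complex.norm_real, Real.norm_of_nonneg (Real.rpow_nonneg (hq0 _) _)]
    obtain ⟨A, φ1, hAc, hA, hA'⟩ := hpow2 1 one_pos
    obtain ⟨B, φ2, hBc, hB, hB'⟩ := hpow2 2 two_pos
    have hpre : ∀ φ : X ≃ₜ X, Dense (φ ⁻¹' D) ∧ IsOpen (φ ⁻¹' D) := fun φ =>
      ⟨hD.preimage φ.isOpenMap, hDo.preimage φ.continuous⟩
    have hW := (hpre φ1).1.inter_of_isOpen_left (hpre φ2).1 (hpre φ1).2
    have hO : IsOpen {y | A y ^ 2 < B y} := isOpen_lt (hAc.pow 2) hBc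
    have hy0 : y0 ∈ {y | A y ^ 2 < B y} := by
      change A y0 ^ 2 < B y0
      rw [hA, hB, Real.rpow_one, Real.rpow_two]
      have hcp : 0 < ‖c y0‖ := norm_pos_iff.2 (hc0 y0)
      have : 0 < q (ψ y0) ^ 2 := by positivity
      nlinarith [mul_pos hcp this]
    obtain ⟨ys, hysO, hys1, hys2⟩ := hW.inter_open_nonempty _ hO ⟨y0, hy0⟩
    have hAe : ∀ᶠ y in 𝓝 ys, A y = A ys := by
      have : ∀ᶠ y in 𝓝 (φ1 ys), q y = q (φ1 ys) := hys1
      filter_upwards [φ1.continuous.continuousAt.eventually this] with y hy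
      rw [hA', hA', hy]
    have hBe : ∀ᶠ y in 𝓝 ys, B y = B ys := by
      have : ∀ᶠ y in 𝓝 (φ2 ys), q y = q (φ2 ys) := hys2
      filter_upwards [φ2.continuous.continuousAt.eventually this] with y hy
      rw [hB', hB', hy]
    have hlt2 : A ys ^ 2 < B ys := hysO
    set t := ‖c ys‖ with ht
    set d := q (ψ ys) with hd
    have htpos : 0 < t := norm_pos_iff.2 (hc0 ys)
    have hAs : A ys = t * d := by rw [hA, Real.rpow_one]
    have hBs : B ys = t * d ^ 2 := by rw [hB, Real.rpow_two]
    have hdpos : 0 < d := by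
      rcases (hq0 (ψ ys)).lt_or_eq with h | h
      · exact h
      · exfalso
        have : d = 0 := h.symm
        rw [hAs, hBs, this] at hlt2
        norm_num at hlt2
    have htlt : t < 1 := by
      rw [hAs, hBs] at hlt2
      by_contra hge
      have : 0 < t * d ^ 2 := by positivity
      nlinarith
    have hev : ∀ᶠ y in 𝓝 ys, ‖c y‖ = t ∧ q (ψ y) = d := by
      filter_upwards [hAe, hBe] with y hy1 hy2
      rw [hAs, hA, Real.rpow_one] at hy1
      rw [hBs, hB, Real.rpow_two] at hy2
      have h3 : q (ψ y) * (t * d) = d * (t * d) := by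
        rw [← hy1]
        calc _ = ‖c y‖ * q (ψ y) ^ 2 := by ring
          _ = d * (t * d) := by rw [hy2]; ring
          _ = _ := by rw [hy1]
      have h4 : q (ψ y) = d := mul_right_cancel₀ (by positivity) h3
      refine ⟨?_, h4⟩
      rw [h4] at hy1
      exact mul_right_cancel₀ hdpos.ne' hy1
    obtain ⟨V, hV, hVo, hysV⟩ := eventually_nhds_iff.1 hev
    have hlev : ∀ a ∈ Set.Ioi (0 : ℝ), (interior {x | q x = t ^ a * d}).Nonempty := by
      intro a ha
      have ha' : (0 : ℝ) < a := ha
      obtain ⟨E, φ, hEc, hE, hE'⟩ := hpow2 a⁻¹ (inv_pos.2 ha')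
      refine ⟨φ ys, mem_interior.2 ⟨φ '' V, ?_, φ.isOpenMap V hVo, ⟨ys, hysV, rfl⟩⟩⟩
      rintro _ ⟨y, hy, rfl⟩
      change q (φ y) = t ^ a * d
      have h5 := hE' y
      rw [hE, (hV y hy).1, (hV y hy).2] at h5
      have h6 : (q (φ y) ^ a⁻¹) ^ a = (t * d ^ a⁻¹) ^ a := by rw [h5]
      rw [Real.mul_rpow htpos.le (by positivity), Real.rpow_inv_rpow (hq0 _) ha'.ne',
        Real.rpow_inv_rpow hdpos.le ha'.ne'] at h6
      exact h6
    have hdisj : (Set.Ioi (0 : ℝ)).PairwiseDisjoint (fun a => {x | q x = t ^ a * d}) := by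
      intro a _ b _ hab
      refine Set.disjoint_left.2 fun x hx hx' => hab ?_
      have hx1 : q x = t ^ a * d := hx
      have hx2 : q x = t ^ b * d := hx'
      rw [hx1] at hx2
      have := mul_right_cancel₀ hdpos.ne' hx2
      exact (Real.rpow_right_inj htpos htlt.ne).1 this
    have hcount := hdisj.countable_of_nonempty_interior hlev
    have hle := Cardinal.le_aleph0_iff_set_countable.2 hcount
    rw [Cardinal.mk_Ioi_real] at hle
    exact absurd hle (not_le.2 Cardinal.aleph0_lt_continuum)
  have hnorm : ∀ f y, ‖F f y‖ = ‖f (ψ y)‖ := fun f y => by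
    rw [hFc, norm_mul, hc1, one_mul]
  have hψc : Continuous ψ := c0_continuous_of ψ F hnorm
  have hψi : Function.Injective ψ := by
    intro y y' hyy
    obtain ⟨p, q, hp, hp0, hp1, hpq, -⟩ := c0_peak (ψ y) (U := Set.univ) univ_mem
    obtain ⟨φ, hφ⟩ := hF p
    have hh : ∀ z, ψ z = ψ y → φ z = ψ y := by
      intro z hz
      have h2 := hφ z
      rw [hnorm, hz, hp, hp, (hpq _).2 rfl, Complex.norm_real, Complex.norm_real,
        Real.norm_of_nonneg (hp0 _), norm_one] at h2
      exact (hpq _).1 h2.symm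
    exact φ.injective ((hh y rfl).trans (hh y' hyy.symm).symm)
  have hψs : Function.Surjective ψ := by
    intro x
    obtain ⟨p, q, hp, hp0, hp1, hpq, -⟩ := c0_peak x (U := Set.univ) univ_mem
    obtain ⟨φ, hφ⟩ := hF p
    refine ⟨φ.symm x, ?_⟩
    have h2 := hφ (φ.symm x)
    rw [hnorm, φ.apply_symm_apply, hp, hp, (hpq x).2 rfl, Complex.norm_real, Complex.norm_real,
        Real.norm_of_nonneg (hp0 _), norm_one] at h2
    exact (hpq _).1 h2
  have hcl : IsClosedMap ψ := by
    refine (isProperMap_iff_tendsto_cocompact.2 ⟨hψc, ?_⟩).isClosedMap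
    intro s hs
    obtain ⟨K, hK, hKs⟩ := Filter.mem_cocompact.1 hs
    rw [Filter.mem_map, Filter.mem_cocompact]
    rcases K.eq_empty_or_nonempty with rfl | hKne
    · refine ⟨∅, isCompact_empty, fun y _ => hKs (by simp)⟩
    · obtain ⟨x0, -, hx0⟩ := hK.exists_isMinOn hKne (map_continuous g).norm.continuousOn
      refine ⟨_, c0_compact (F g) (norm_pos_iff.2 (hg0 x0)), fun y hy => hKs fun hyK => hy ?_⟩
      change _ ≤ ‖F g y‖
      rw [hnorm]
      exact hx0 hyK
  let σ := (Equiv.ofBijective ψ ⟨hψi, hψs⟩).toHomeomorphOfContinuousClosed hψc hcl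
  have hσ : ∀ y, σ y = ψ y := fun y => rfl
  have hcc : Continuous c := by
    have : c = fun y => F g y / g (ψ y) := by
      ext y
      rw [hFc]
      have := hg0 (ψ y)
      field_simp
    rw [this]
    exact (map_continuous (F g)).div ((map_continuous g).comp hψc) fun y => hg0 _
  intro u
  let f : C₀(X, ℂ) := ⟨⟨fun x => u (σ.symm x) / c (σ.symm x),
    ((map_continuous u).comp σ.symm.continuous).div (hcc.comp σ.symm.continuous)
      fun x => hc0 _⟩, by
    have h3 : Tendsto (fun x => ‖u (σ.symm x)‖) (cocompact X) (𝓝 0) := by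
      have := ((zero_at_infty u).norm).comp σ.symm.isClosedEmbedding.tendsto_cocompact
      rw [norm_zero] at this
      exact this
    refine squeeze_zero_norm (fun x => ?_) h3
    change ‖u (σ.symm x) / c (σ.symm x)‖ ≤ _
    rw [norm_div, hc1, div_one]⟩
  refine ⟨f, ?_⟩
  ext y
  rw [hFc]
  change c y * (u (σ.symm (ψ y)) / c (σ.symm (ψ y))) = u y
  rw [← hσ, σ.symm_apply_apply]
  exact mul_div_cancel₀ _ (hc0 y)

theorem c0_exists_pos {X : Type*} [MetricSpace X] [LocallyCompactSpace X]
    [SecondCountableTopology X] : ∃ (g : C₀(X, ℂ)) (q : X → ℝ), (∀ x, g x = (q x : ℂ)) ∧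
      ∀ x, 0 < q x := by
  rcases isEmpty_or_nonempty X with hX | hX
  · exact ⟨0, fun _ => 0, fun x => (hX.false x).elim, fun x => (hX.false x).elim⟩
  choose p q hp hp0 hp1 hpq _h using fun x : X => c0_peak x (U := Set.univ) univ_mem
  have hqc : ∀ x, Continuous (q x) := fun x => by
    have : q x = fun y => (p x y).re := by ext y; simp [hp]
    rw [this]; fun_prop
  obtain ⟨s, hs, hsU⟩ := TopologicalSpace.isOpen_iUnion_countable (fun x : X => {y | 0 < q x y})
    (fun x => isOpen_lt continuous_const (hqc x))
  have hcov : ∀ y, ∃ x ∈ s, 0 < q x y := by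
    intro y
    have : y ∈ ⋃ x ∈ s, {y | 0 < q x y} := by
      rw [hsU]
      exact Set.mem_iUnion.2 ⟨y, by simp [(hpq y y).2 rfl]⟩
    simpa using this
  have hsne : s.Nonempty := by
    obtain ⟨x, hx, -⟩ := hcov (Classical.arbitrary X)
    exact ⟨x, hx⟩
  obtain ⟨e, he⟩ := hs.exists_eq_range hsne
  have hpn : ∀ x, ‖p x‖ ≤ 1 := fun x => c0_norm_le _ zero_le_one fun y => by
    rw [hp, Complex.norm_real, Real.norm_of_nonneg (hp0 _ _)]; exact hp1 x y
  have hsum : Summable fun n : ℕ => ((((1 / 2 : ℝ) ^ n : ℝ)) : ℂ) • p (e n) := by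
    refine Summable.of_norm_bounded (g := fun n : ℕ => (1 / 2 : ℝ) ^ n)
      summable_geometric_two fun n => ?_
    rw [norm_smul, Complex.norm_real, Real.norm_of_nonneg (by positivity)]
    exact mul_le_of_le_one_right (by positivity) (hpn _)
  have hsumq : ∀ y, Summable fun n : ℕ => (1 / 2 : ℝ) ^ n * q (e n) y := fun y => by
    refine Summable.of_nonneg_of_le (fun n => mul_nonneg (by positivity) (hp0 _ _))
      (fun n => ?_) summable_geometric_two
    exact mul_le_of_le_one_right (by positivity) (hp1 _ _)
  refine ⟨∑' n, ((((1 / 2 : ℝ) ^ n : ℝ)) : ℂ) • p (e n),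
    fun y => ∑' n, (1 / 2 : ℝ) ^ n * q (e n) y, fun y => ?_, fun y => ?_⟩
  · let ev : C₀(X, ℂ) →L[ℂ] ℂ := LinearMap.mkContinuous
      { toFun := fun f => f y
        map_add' := fun f g => rfl
        map_smul' := fun c f => rfl } 1 (fun f => by
          rw [one_mul]; exact c0_norm_apply_le f y)
    have h1 := ev.map_tsum hsum
    have h2 : ∀ f, ev f = f y := fun f => rfl
    rw [h2] at h1
    rw [h1, Complex.ofReal_tsum]
    refine tsum_congr fun n => ?_
    rw [h2, ZeroAtInftyContinuousMap.smul_apply, hp, smul_eq_mul, Complex.ofReal_mul]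
  · obtain ⟨x, hx, hxy⟩ := hcov y
    rw [he] at hx
    obtain ⟨n, rfl⟩ := hx
    exact (hsumq y).tsum_pos (fun n => mul_nonneg (by positivity) (hp0 _ _)) n (by positivity)

end GeneralSpace

open MeasureTheory in
theorem exists_staircase (r : ℝ) (hr : 0 < r) : ∃ (U : Set ℝ) (N : ℝ → ℝ), Dense U ∧
    Continuous N ∧ (∀ t ∈ U, ∀ᶠ s in 𝓝 t, N s = N t) ∧
    ∀ a t, r ≤ |t - a| → r / 2 ≤ |N t - N a| := by
  obtain ⟨U, hQU, hUo, hUv⟩ := (Set.range ((↑) : ℚ → ℝ)).exists_isOpen_lt_of_lt (μ := volume)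
    (ENNReal.ofReal (r / 2)) (by
      rw [(Set.countable_range _).measure_zero]
      simpa using hr)
  have hint : ∀ a b, IntervalIntegrable (U.indicator (fun _ => (1 : ℝ))) volume a b := by
    intro a b
    rw [intervalIntegrable_iff]
    exact (integrableOn_const (by simp)).indicator hUo.measurableSet
  have hadd : ∀ a b, (∫ s in (0 : ℝ)..b, U.indicator (fun _ => (1 : ℝ)) s) -
      (∫ s in (0 : ℝ)..a, U.indicator (fun _ => (1 : ℝ)) s) =
      ∫ s in a..b, U.indicator (fun _ => (1 : ℝ)) s := fun a b =>
    intervalIntegral.integral_interval_sub_left (hint _ _) (hint _ _)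
  have hbd : ∀ a b, |∫ s in a..b, U.indicator (fun _ => (1 : ℝ)) s| ≤ r / 2 := by
    intro a b
    have h1 : |∫ s in a..b, U.indicator (fun _ => (1 : ℝ)) s| =
        |∫ s in Set.uIoc a b, U.indicator (fun _ => (1 : ℝ)) s| :=
      intervalIntegral.abs_integral_eq_abs_integral_uIoc _
    rw [h1, integral_indicator hUo.measurableSet, setIntegral_const, smul_eq_mul, mul_one,
      abs_of_nonneg measureReal_nonneg, Measure.real]
    refine ENNReal.toReal_le_of_le_ofReal (by positivity) ?_
    refine le_trans ?_ hUv.le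
    exact Measure.restrict_apply_le _ _
  refine ⟨U, fun t => t - ∫ s in (0 : ℝ)..t, U.indicator (fun _ => (1 : ℝ)) s,
    Rat.denseRange_cast.mono hQU, ?_, ?_, ?_⟩
  · exact continuous_id.sub (intervalIntegral.continuous_primitive hint 0)
  · intro t ht
    obtain ⟨ε, hε, hεU⟩ := Metric.isOpen_iff.1 hUo t ht
    filter_upwards [Metric.ball_mem_nhds t hε] with s hs
    have h2 : ∫ u in t..s, U.indicator (fun _ => (1 : ℝ)) u = ∫ u in t..s, (1 : ℝ) := by
      refine intervalIntegral.integral_congr fun u hu => ?_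
      have : u ∈ U := by
        apply hεU
        exact (convex_ball t ε).ordConnected.uIcc_subset (Metric.mem_ball_self hε) hs hu
      simp [this]
    have h3 := hadd t s
    rw [h2] at h3
    simp only [intervalIntegral.integral_const, smul_eq_mul, mul_one] at h3
    linarith
  · intro a t hat
    have h1 := hadd a t
    have h2 := hbd a t
    rw [← h1] at h2
    simp only
    set P := ∫ s in (0 : ℝ)..t, U.indicator (fun _ => (1 : ℝ)) s
    set Q := ∫ s in (0 : ℝ)..a, U.indicator (fun _ => (1 : ℝ)) s
    have h3 : |t - a| ≤ |t - P - (a - Q)| + |P - Q| := by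
      have : t - a = (t - P - (a - Q)) + (P - Q) := by ring
      rw [this]
      exact abs_add_le _ _
    linarith

theorem exists_plateau {n : ℕ} (Ω : Set (EuclideanSpace ℝ (Fin n))) (hopen : IsOpen Ω) (x : Ω) :
    ∃ (q : Ω → ℝ) (K : Set Ω), Continuous q ∧ (∀ y, 0 ≤ q y) ∧ 0 < q x ∧
      IsCompact K ∧ (∀ y, y ∉ K → q y = 0) ∧ Dense {z | ∀ᶠ y in 𝓝 z, q y = q z} := by
  let e : EuclideanSpace ℝ (Fin n) ≃ₜ (Fin n → ℝ) :=
    (EuclideanSpace.equiv (Fin n) ℝ).toHomeomorph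
  have he : ∀ (y : EuclideanSpace ℝ (Fin n)) i, e y i = y i := fun y i => rfl
  let j : Ω → (Fin n → ℝ) := fun y => e y.1
  have hj : Topology.IsOpenEmbedding j :=
    e.isOpenEmbedding.comp hopen.isOpenEmbedding_subtypeVal
  have hnh : Set.range j ∈ 𝓝 (j x) := hj.isOpen_range.mem_nhds ⟨x, rfl⟩
  obtain ⟨r, hr, hrj⟩ := Metric.nhds_basis_closedBall.mem_iff.1 hnh
  obtain ⟨U, N, hU, hN, hNU, hNr⟩ := exists_staircase r hr
  have hjc : ∀ i, Continuous fun y : Ω => j y i := fun i => (continuous_apply i).comp hj.continuous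
  refine ⟨fun y => max 0 (r / 2 - ∑ i, |N (j y i) - N (j x i)|), j ⁻¹' Metric.closedBall (j x) r,
    ?_, fun y => le_max_left _ _, ?_, ?_, ?_, ?_⟩
  · refine continuous_const.max (continuous_const.sub (continuous_finsetSum _ fun i _ => ?_))
    exact ((hN.comp (hjc i)).sub continuous_const).abs
  · simp [hr]
  · rw [hj.isInducing.isCompact_preimage_iff hrj]
    exact isCompact_closedBall _ _
  · intro y hy
    refine max_eq_left ?_
    have h1 : ¬ ∀ i, dist (j y i) (j x i) ≤ r := fun h => hy ((dist_pi_le_iff hr.le).2 h)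
    push Not at h1
    obtain ⟨i, hi⟩ := h1
    rw [Real.dist_eq] at hi
    have h2 := hNr (j x i) (j y i) hi.le
    have h3 := Finset.single_le_sum (f := fun i => |N (j y i) - N (j x i)|)
      (fun i _ => abs_nonneg _) (Finset.mem_univ i)
    linarith
  · have hd : Dense (Set.pi Set.univ fun _ : Fin n => U) := dense_pi _ fun i _ => hU
    refine (hd.preimage hj.isOpenMap).mono fun z hz => ?_
    have h1 : ∀ i, ∀ᶠ y in 𝓝 z, N (j y i) = N (j z i) := fun i =>
      (hjc i).continuousAt.eventually (hNU _ (hz i (Set.mem_univ i)))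
    have h2 : ∀ᶠ y in 𝓝 z, ∀ i, N (j y i) = N (j z i) := eventually_all.2 h1
    change ∀ᶠ y in 𝓝 z, _ = _
    filter_upwards [h2] with y hy
    simp only [hy]

/-- For a nonempty open convex set `Ω ⊆ ℝⁿ`, the group of surjective
linear isometries of `C₀(Ω)` is algebraically reflexive. -/
theorem iso_reflexive_C0_of_open_convex
    (n : ℕ) (Ω : Set (EuclideanSpace ℝ (Fin n)))
    (hopen : IsOpen Ω) (hconv : Convex ℝ Ω) (hne : Ω.Nonempty)
    (F : C₀(Ω, ℂ) →L[ℂ] C₀(Ω, ℂ))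
    (hF : ∀ f : C₀(Ω, ℂ), ∃ S : C₀(Ω, ℂ) → C₀(Ω, ℂ),
      IsSurjectiveLinearIsometry S ∧ F f = S f) :
    IsSurjectiveLinearIsometry (⇑F) := by
  have : LocallyCompactSpace Ω := hopen.locallyCompactSpace
  refine ⟨⟨map_add F, map_smul F⟩, ?_, fun f => ?_⟩
  · obtain ⟨g, gq, hgq, hgpos⟩ := c0_exists_pos (X := Ω)
    refine c0_general (m := n) (fun i (y : Ω) => y.1 i) (fun i => by fun_prop) ?_ g gq hgq hgpos
      (exists_plateau Ω hopen) F.toLinearMap ?_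
    · intro x y h
      apply Subtype.ext
      ext i
      exact h i
    · intro f
      obtain ⟨S, ⟨h1, h2, h3⟩, h4⟩ := hF f
      obtain ⟨φ, hφ⟩ := c0_banach_stone S h1 h2 h3
      refine ⟨φ, fun y => ?_⟩
      rw [← hφ, ← h4]
      rfl
  · obtain ⟨S, ⟨h1, h2, h3⟩, h4⟩ := hF f
    rw [h4, h3]
end

section
/- The automorphism group of C₀(ℝ, B(H)) (the suspension of B(H)) is algebraically reflexive: every bounded linear map Φ on C₀(ℝ, B(H)) such that for each f ∈ C₀(ℝ, B(H)) there exists an automorphism Φ_f of C₀(ℝ, B(H)) with Φ(f) = Φ_f(f), is itself an automorphism of C₀(ℝ, B(H)). -/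
open scoped ZeroAtInfty

/-- An automorphism of a (not necessarily unital) algebra: a multiplicative linear bijection. -/
def IsAlgebraAutomorphism {A : Type*} [NonUnitalNonAssocSemiring A] [Module ℂ A]
    (Φ : A → A) : Prop :=
  IsLinearMap ℂ Φ ∧ (∀ a b : A, Φ (a * b) = Φ a * Φ b) ∧ Function.Bijective Φ

set_option linter.unusedVariables false
set_option linter.unusedSimpArgs false
set_option linter.unusedSectionVars false

section P1
variable {H : Type*} [NormedAddCommGroup H] [InnerProductSpace ℂ H]

/-- rank-one operator -/
noncomputable def rk (x : H) (f : H →L[ℂ] ℂ) : H →L[ℂ] H := f.smulRight x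

@[simp] lemma rk_apply (x : H) (f : H →L[ℂ] ℂ) (y : H) : rk x f y = f y • x := rfl

lemma rk_add_left (x y : H) (f : H →L[ℂ] ℂ) : rk (x + y) f = rk x f + rk y f := by
  ext z; simp
lemma rk_add_right (x : H) (f g : H →L[ℂ] ℂ) : rk x (f + g) = rk x f + rk x g := by
  ext z; simp [add_smul]
lemma rk_smul_left (c : ℂ) (x : H) (f : H →L[ℂ] ℂ) : rk (c • x) f = c • rk x f := by
  ext z; simp [smul_smul, mul_comm]
lemma rk_smul_right (c : ℂ) (x : H) (f : H →L[ℂ] ℂ) : rk x (c • f) = c • rk x f := by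
  ext z; simp [mul_smul]
lemma rk_sub_left (x y : H) (f : H →L[ℂ] ℂ) : rk (x - y) f = rk x f - rk y f := by
  ext z; simp [smul_sub]
lemma rk_sub_right (x : H) (f g : H →L[ℂ] ℂ) : rk x (f - g) = rk x f - rk x g := by
  ext z; simp [sub_smul]
@[simp] lemma rk_zero_left (f : H →L[ℂ] ℂ) : rk (0 : H) f = 0 := by ext z; simp
@[simp] lemma rk_zero_right (x : H) : rk x (0 : H →L[ℂ] ℂ) = 0 := by ext z; simp

lemma exists_fun {x : H} (hx : x ≠ 0) : ∃ f : H →L[ℂ] ℂ, f x = 1 :=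
  SeparatingDual.exists_eq_one hx

lemma exists_vec {f : H →L[ℂ] ℂ} (hf : f ≠ 0) : ∃ x : H, f x = 1 := by
  obtain ⟨x, hx⟩ : ∃ x, f x ≠ 0 := by
    by_contra! h; exact hf (by ext x; simp [h])
  exact ⟨(f x)⁻¹ • x, by simp [hx]⟩

lemma rk_eq_zero {x : H} {f : H →L[ℂ] ℂ} : rk x f = 0 ↔ x = 0 ∨ f = 0 := by
  constructor
  · intro h
    by_contra! hc
    obtain ⟨y, hy⟩ := exists_vec hc.2
    have := congrArg (fun T : H →L[ℂ] H => T y) h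
    simp [hy] at this
    exact hc.1 this
  · rintro (h | h) <;> simp [h]

lemma rk_mul (x y : H) (f g : H →L[ℂ] ℂ) : rk x f * rk y g = f y • rk x g := by
  ext z; simp [smul_smul, mul_comm]

lemma rk_of_alg {R : H →L[ℂ] H} (h : ∀ T : H →L[ℂ] H, ∃ c : ℂ, R * T * R = c • R) :
    ∃ u v, R = rk u v := by
  by_cases hR : R = 0
  · exact ⟨0, 0, by simp [hR]⟩
  obtain ⟨y, hy⟩ : ∃ y, R y ≠ 0 := by
    by_contra! h; exact hR (by ext x; simp [h])
  obtain ⟨g, hg⟩ := exists_fun hy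
  refine ⟨R y, g.comp R, ?_⟩
  ext w
  obtain ⟨c, hc⟩ := h (rk w g)
  have := congrArg (fun T : H →L[ℂ] H => T y) hc
  simp [hg] at this
  simp [this, hg]

lemma rk_alg (x : H) (f : H →L[ℂ] ℂ) (T : H →L[ℂ] H) :
    rk x f * T * rk x f = f (T x) • rk x f := by
  ext z; simp [smul_smul, mul_comm]

lemma rk_adj {a u : H} {b v : H →L[ℂ] ℂ} (ha : a ≠ 0) (hb : b ≠ 0)
    (h : ∃ w z, rk a b + rk u v = rk w z) : (∃ c : ℂ, u = c • a) ∨ (∃ c : ℂ, v = c • b) := by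
  obtain ⟨w, z, h⟩ := h
  have h' : ∀ y, b y • a + v y • u = z y • w := fun y => by
    have := congrArg (fun T : H →L[ℂ] H => T y) h
    simpa using this
  by_cases hv : ∀ y, b y = 0 → v y = 0
  · right
    obtain ⟨y0, hy0⟩ := exists_vec hb
    refine ⟨v y0, ?_⟩
    ext y
    have := hv (y - b y • y0) (by simp [hy0])
    simp at this
    simp
    linear_combination this
  · left
    push Not at hv
    obtain ⟨y, hy, hvy⟩ := hv
    by_cases hu : u = 0
    · exact ⟨0, by simp [hu]⟩
    have h1 := h' y
    rw [hy, zero_smul, zero_add] at h1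
    have hz : z y ≠ 0 := by
      intro hz
      rw [hz, zero_smul] at h1
      exact (smul_ne_zero hvy hu) h1
    have hw : w = ((z y)⁻¹ * v y) • u := by
      rw [mul_smul, h1, smul_smul, inv_mul_cancel₀ hz, one_smul]
    obtain ⟨y0, hy0⟩ := exists_vec hb
    have h2 := h' y0
    rw [hy0, one_smul, hw, smul_smul] at h2
    set k := z y0 * ((z y)⁻¹ * v y) - v y0
    have h3 : a = k • u := by rw [sub_smul, ← h2]; abel
    have hk : k ≠ 0 := by
      intro hk; rw [hk, zero_smul] at h3; exact ha h3
    exact ⟨k⁻¹, by rw [h3, smul_smul, inv_mul_cancel₀ hk, one_smul]⟩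

lemma rk_dich {V : Type*} [AddCommGroup V] [Module ℂ V] (G : V →ₗ[ℂ] (H →L[ℂ] H))
    (hG : ∀ x, ∃ u v, G x = rk u v) {x0 : V} {a : H} {b : H →L[ℂ] ℂ} (ha : a ≠ 0) (hb : b ≠ 0)
    (h0 : G x0 = rk a b) : (∀ x, ∃ v, G x = rk a v) ∨ (∀ x, ∃ u, G x = rk u b) := by
  have key : ∀ x, (∃ v, G x = rk a v) ∨ (∃ u, G x = rk u b) := by
    intro x
    obtain ⟨u, v, hx⟩ := hG x
    obtain ⟨w, z, hw⟩ := hG (x0 + x)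
    rw [map_add, h0, hx] at hw
    rcases rk_adj ha hb ⟨w, z, hw⟩ with ⟨c, rfl⟩ | ⟨c, rfl⟩
    · left; exact ⟨c • v, by rw [hx, rk_smul_left, rk_smul_right]⟩
    · right; exact ⟨c • u, by rw [hx, rk_smul_left, rk_smul_right]⟩
  by_contra! hc
  obtain ⟨⟨x1, h1⟩, ⟨x2, h2⟩⟩ := hc
  obtain ⟨u1, hu1⟩ := (key x1).resolve_left (by push Not; exact h1)
  obtain ⟨v2, hv2⟩ := (key x2).resolve_right (by push Not; exact h2)
  rcases key (x1 + x2) with ⟨v, hv⟩ | ⟨u, hu⟩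
  · refine h1 (v - v2) ?_
    rw [rk_sub_right, ← hv, ← hv2, map_add]; abel
  · refine h2 (u - u1) ?_
    rw [rk_sub_left, ← hu, ← hu1, map_add]; abel

lemma rk_common {p u : H} {v q : H →L[ℂ] ℂ} (hq : q ≠ 0) (h : rk p v = rk u q) :
    ∃ γ : ℂ, rk p v = γ • rk p q := by
  obtain ⟨y, hy⟩ := exists_vec hq
  have := congrArg (fun T : H →L[ℂ] H => T y) h
  simp [hy] at this
  refine ⟨v y, ?_⟩
  rw [h, ← this, rk_smul_left]

lemma isUnit_one_add_rk (w : H) (f : H →L[ℂ] ℂ) : IsUnit (1 + rk w f) ↔ 1 + f w ≠ 0 := by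
  constructor
  · intro h h0
    obtain ⟨S, hS⟩ := h.exists_left_inv
    have h1 := congrArg (fun T : H →L[ℂ] H => T w) hS
    simp only [mul_apply_eq_comp, add_apply,
      one_apply_eq_self, rk_apply] at h1
    have h2 : w + f w • w = 0 := by
      rw [show w + f w • w = (1 + f w) • w by rw [add_smul, one_smul], h0, zero_smul]
    rw [h2, map_zero] at h1
    rw [← h1] at h0
    simp at h0
  · intro h
    refine isUnit_iff_exists.mpr ⟨1 - (1 + f w)⁻¹ • rk w f, ?_, ?_⟩
    · ext z
      simp only [mul_apply_eq_comp, add_apply,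
        one_apply_eq_self, rk_apply, sub_apply,
        smul_apply, map_sub, map_smul, smul_eq_mul]
      match_scalars <;> field_simp
      ring
    · ext z
      simp only [mul_apply_eq_comp, add_apply,
        one_apply_eq_self, rk_apply, sub_apply,
        smul_apply, map_sub, map_smul, smul_eq_mul, map_add]
      match_scalars <;> field_simp
      ring

lemma isUnit_add_rk {T S : H →L[ℂ] H} (h1 : T * S = 1) (h2 : S * T = 1) (x : H)
    (f : H →L[ℂ] ℂ) : IsUnit (T + rk x f) ↔ 1 + f (S x) ≠ 0 := by
  have : T + rk x f = T * (1 + rk (S x) f) := by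
    have h3 : T (S x) = x := congrArg (fun T : H →L[ℂ] H => T x) h1
    ext z; simp [h3]
  have hT : IsUnit T := isUnit_iff_exists.mpr ⟨S, h1, h2⟩
  rw [this, hT.mul_left_iff, isUnit_one_add_rk] 

lemma scal_eq {α β : ℂ} (h : ∀ c : ℂ, 1 + c * α ≠ 0 ↔ 1 + c * β ≠ 0) : α = β := by
  by_cases ha : α = 0
  · by_contra hb
    subst ha
    have hb' : β ≠ 0 := fun h => hb h.symm
    have := (h (-β⁻¹)).1 (by simp)
    exact this (by field_simp; ring)
  · have := (not_congr (h (-α⁻¹))).1 (by push Not; field_simp; ring)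
    push Not at this
    field_simp at this
    linear_combination this

/-- `Ψ` is a local automorphism. -/
def IsLoc (Ψ : (H →L[ℂ] H) →L[ℂ] (H →L[ℂ] H)) : Prop :=
  ∀ T, ∃ τ : (H →L[ℂ] H) ≃ₐ[ℂ] (H →L[ℂ] H), Ψ T = τ T

variable {Ψ : (H →L[ℂ] H) →L[ℂ] (H →L[ℂ] H)}

lemma IsLoc.rk (h : IsLoc Ψ) (x : H) (f : H →L[ℂ] ℂ) : ∃ u v, Ψ (rk x f) = rk u v := by
  obtain ⟨τ, hτ⟩ := h (_root_.rk x f)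
  apply rk_of_alg
  intro T
  refine ⟨f (τ.symm T x), ?_⟩
  rw [hτ, ← map_smul, ← rk_alg, map_mul, map_mul, AlgEquiv.apply_symm_apply]

lemma IsLoc.eq_zero (h : IsLoc Ψ) {T} (hT : Ψ T = 0) : T = 0 := by
  obtain ⟨τ, hτ⟩ := h T
  rw [hτ] at hT
  simpa using hT

lemma IsLoc.isUnit (h : IsLoc Ψ) (T) : IsUnit (Ψ T) ↔ IsUnit T := by
  obtain ⟨τ, hτ⟩ := h T
  rw [hτ]
  exact MulEquiv.isUnit_map τ

lemma IsLoc.one (h : IsLoc Ψ) : Ψ 1 = 1 := by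
  obtain ⟨τ, hτ⟩ := h 1
  rw [hτ, map_one]

lemma IsLoc.star (h : IsLoc Ψ) {x u : H} {f v : H →L[ℂ] ℂ} (hR : Ψ (_root_.rk x f) = _root_.rk u v)
    {T S T' S' : H →L[ℂ] H} (h1 : T * S = 1) (h2 : S * T = 1) (hT : Ψ T = T')
    (h1' : T' * S' = 1) (h2' : S' * T' = 1) : f (S x) = v (S' u) := by
  apply scal_eq
  intro c
  have e1 := isUnit_add_rk h1 h2 x (c • f)
  have e2 := isUnit_add_rk h1' h2' u (c • v)
  simp only [smul_apply, smul_eq_mul] at e1 e2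
  rw [← e1, ← e2, ← h.isUnit, map_add, hT, rk_smul_right, rk_smul_right, map_smul, hR]

lemma IsLoc.tr (h : IsLoc Ψ) {x u : H} {f v : H →L[ℂ] ℂ}
    (hR : Ψ (_root_.rk x f) = _root_.rk u v) : f x = v u := by
  simpa using h.star hR (T := 1) (S := 1) (by simp) (by simp) h.one (S' := 1) (by simp) (by simp)

lemma one_add_inv (x : H) (f : H →L[ℂ] ℂ) (s : ℂ) (hs : 1 + s * f x ≠ 0) :
    (1 + s • rk x f) * (1 - (s / (1 + s * f x)) • rk x f) = 1 ∧
     (1 - (s / (1 + s * f x)) • rk x f) * (1 + s • rk x f) = 1 := by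
  constructor
  · rw [add_mul, mul_sub, mul_sub, smul_mul_smul_comm, rk_mul]
    simp only [one_mul, mul_one]
    match_scalars <;> field_simp
    ring
  · rw [sub_mul, mul_add, mul_add, smul_mul_smul_comm, rk_mul]
    simp only [one_mul, mul_one]
    match_scalars <;> field_simp
    ring

lemma IsLoc.tr2 (h : IsLoc Ψ) {x u y u' : H} {f v g v' : H →L[ℂ] ℂ}
    (hR : Ψ (_root_.rk x f) = _root_.rk u v) (hR' : Ψ (_root_.rk y g) = _root_.rk u' v') :
    f y * g x = v u' * v' u := by
  obtain ⟨s, hs0, hs⟩ : ∃ s : ℂ, s ≠ 0 ∧ 1 + s * g y ≠ 0 := by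
    by_cases hg : g y = 0
    · exact ⟨1, by simp, by simp [hg]⟩
    · exact ⟨(g y)⁻¹, by simp [hg], by simp [hg]⟩
  have ht := h.tr hR
  have ht' := h.tr hR'
  obtain ⟨i1, i2⟩ := one_add_inv y g s hs
  obtain ⟨i1', i2'⟩ := one_add_inv u' v' s (ht' ▸ hs)
  have := h.star hR i1 i2 (by rw [map_add, h.one, map_smul, hR']) i1' i2'
  simp [ht, ht'] at this
  rw [ht'] at hs
  field_simp at this
  have := (this.resolve_right (by simp [hs0, hs]))
  linear_combination this

end P1

section P2
variable {H : Type*} [NormedAddCommGroup H] [InnerProductSpace ℂ H] [CompleteSpace H]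

lemma exists_ortho (hH : ¬ FiniteDimensional ℂ H) {e : H} (he : ‖e‖ = 1) :
    ∃ w : ℕ → H, Orthonormal ℂ w ∧ ∀ n, inner ℂ (w n) e = 0 := by
  have hs : Orthonormal ℂ ((↑) : ({e} : Set H) → H) := by
    refine ⟨?_, ?_⟩
    · rintro ⟨x, hx⟩; simp at hx; simp [hx, he]
    · rintro ⟨x, hx⟩ ⟨y, hy⟩ hxy; simp at hx hy; simp [hx, hy] at hxy
  obtain ⟨w, b, hw, hb⟩ := hs.exists_hilbertBasis_extension
  have hinf : w.Infinite := by
    intro hfin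
    apply hH
    have h1 := b.dense_span
    have : FiniteDimensional ℂ (Submodule.span ℂ (Set.range b)) := by
      rw [hb, Subtype.range_coe]
      exact FiniteDimensional.span_of_finite ℂ hfin
    rw [IsClosed.submodule_topologicalClosure_eq (Submodule.closed_of_finiteDimensional _)] at h1
    rw [h1] at this
    exact Module.finite_def.mpr (by simpa using (Submodule.fg_top _).mp (Module.finite_def.mp this))
  have hinf2 : (w \ {e}).Infinite := hinf.sdiff (Set.finite_singleton e)
  let j := hinf2.natEmbedding
  have hon : Orthonormal ℂ ((↑) : w → H) := hb ▸ b.orthonormal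
  have hinj : Function.Injective (fun n => (⟨(j n : H), (j n).2.1⟩ : w)) := by
    intro m n h
    simp at h
    exact j.injective (Subtype.ext h)
  refine ⟨fun n => (j n : H), hon.comp _ hinj, fun n => ?_⟩
  have he' : e ∈ w := hw rfl
  exact hon.2 (i := ⟨j n, (j n).2.1⟩) (j := ⟨e, he'⟩) (by simpa using (j n).2.2)

lemma exists_K [TopologicalSpace.SeparableSpace H] (hH : ¬ FiniteDimensional ℂ H) {e : H}
    (he : e ≠ 0) : ∃ (K : H →L[ℂ] H) (d : ℕ → H) (f : ℕ → H →L[ℂ] ℂ),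
      HasSum (fun n => rk (d n) (f n)) K ∧ (∀ n, f n e = 0) ∧ ∀ T : H →L[ℂ] H, T * K = 0 → T = 0 := by
  obtain ⟨w, hw, hwe⟩ := exists_ortho hH (e := (‖e‖⁻¹ : ℂ) • e) (by
    rw [norm_smul]; simp [he])
  let d0 := TopologicalSpace.denseSeq H
  let c : ℕ → ℝ := fun n => (1/2)^n / (1 + ‖d0 n‖)
  have hc : ∀ n, 0 < c n := fun n => by positivity
  let d : ℕ → H := fun n => (c n : ℂ) • d0 n
  let f : ℕ → H →L[ℂ] ℂ := fun n => innerSL ℂ (w n)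
  have hsum : Summable (fun n => rk (d n) (f n)) := by
    refine Summable.of_norm_bounded (g := fun n => (1/2 : ℝ)^n) (summable_geometric_two) fun n => ?_
    have h1 : ‖rk (d n) (f n)‖ = ‖f n‖ * ‖d n‖ := ContinuousLinearMap.norm_smulRight_apply _ _
    rw [h1]
    have h2 : ‖f n‖ = 1 := by simp [f, hw.1 n]
    have h3 : ‖d n‖ = c n * ‖d0 n‖ := by
      simp only [d, norm_smul, Complex.norm_real, Real.norm_eq_abs, abs_of_pos (hc n)]
    rw [h2, h3, one_mul]
    simp only [c]
    rw [div_mul_eq_mul_div, div_le_iff₀ (by positivity)]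
    have : (0:ℝ) < (1/2)^n := by positivity
    nlinarith [norm_nonneg (d0 n)]
  refine ⟨∑' n, rk (d n) (f n), d, f, hsum.hasSum, fun n => ?_, fun T hT => ?_⟩
  · have := hwe n
    rw [inner_smul_right] at this
    simpa [f, he] using this
  · have hK : ∀ m, (∑' n, rk (d n) (f n)) (w m) = d m := by
      intro m
      have h1 := (hsum.hasSum).mapL (ContinuousLinearMap.apply ℂ H (w m))
      have h2 : HasSum (fun n => (ContinuousLinearMap.apply ℂ H (w m)) (rk (d n) (f n))) (d m) := by
        convert hasSum_single m ?_ using 1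
        · simp [f, hw.1 m]
        · intro n hn
          simp [f, hw.2 hn]
      exact h1.unique h2
    have h0 : ∀ m, T (d0 m) = 0 := by
      intro m
      have := congrArg (fun T : H →L[ℂ] H => T (w m)) hT
      simp only [mul_apply_eq_comp, hK, d, map_smul] at this
      simpa [(hc m).ne'] using this
    have := (TopologicalSpace.denseRange_denseSeq H).equalizer T.continuous (continuous_const (y := (0:H)))
      (funext h0)
    ext x
    exact congrFun this x

variable {Ψ : (H →L[ℂ] H) →L[ℂ] (H →L[ℂ] H)}

/-- left rank-one action kills -/
lemma kill (h : IsLoc Ψ) {K : H →L[ℂ] H} {d : ℕ → H} {f : ℕ → H →L[ℂ] ℂ}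
    (hK : HasSum (fun n => rk (d n) (f n)) K) (hT : ∀ T : H →L[ℂ] H, T * K = 0 → T = 0)
    (S : H →L[ℂ] H) (hS : ∀ n, S * Ψ (rk (d n) (f n)) = 0) : S = 0 := by
  have h1 : HasSum (fun n => S * Ψ (rk (d n) (f n))) (S * Ψ K) := (hK.mapL Ψ).mul_left S
  simp only [hS] at h1
  have h2 : S * Ψ K = 0 := h1.unique hasSum_zero
  obtain ⟨τ, hτ⟩ := h K
  have h3 := hT (τ.symm S) (by
    apply τ.injective
    rw [map_mul, ← hτ, AlgEquiv.apply_symm_apply, h2, map_zero])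
  simpa using h3

/-- `x ↦ rk x f` -/
noncomputable def rkL (f : H →L[ℂ] ℂ) : H →ₗ[ℂ] (H →L[ℂ] H) where
  toFun x := rk x f
  map_add' x y := rk_add_left x y f
  map_smul' c x := rk_smul_left c x f

noncomputable def rkR (x : H) : (H →L[ℂ] ℂ) →ₗ[ℂ] (H →L[ℂ] H) where
  toFun f := rk x f
  map_add' f g := rk_add_right x f g
  map_smul' c f := rk_smul_right c x f

lemma step1 [TopologicalSpace.SeparableSpace H] (hH : ¬ FiniteDimensional ℂ H) (h : IsLoc Ψ)
    {e : H} {g : H →L[ℂ] ℂ} {a : H} {b : H →L[ℂ] ℂ} (he : g e = 1) (hab : Ψ (rk e g) = rk a b) :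
    ∀ f, ∃ v, Ψ (rk e f) = rk a v := by
  have hba : b a = 1 := by rw [← h.tr hab, he]
  have ha : a ≠ 0 := by rintro rfl; simp at hba
  have hb : b ≠ 0 := by rintro rfl; simp at hba
  have he0 : e ≠ 0 := by rintro rfl; simp at he
  rcases rk_dich (Ψ.toLinearMap ∘ₗ rkR e) (fun f => h.rk e f) ha hb (x0 := g) hab with h1 | h1
  · exact h1
  exfalso
  obtain ⟨K, d, f, hK, hf, hT⟩ := exists_K hH he0
  have := kill h hK hT (rk a b) (fun n => ?_)
  · rw [rk_eq_zero] at this; tauto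
  by_cases hfn : f n = 0
  · simp [hfn]
  obtain ⟨u, v, huv⟩ := h.rk (d n) (f n)
  obtain ⟨w, hw⟩ := h1 (f n)
  replace hw : Ψ (rk e (f n)) = rk w b := hw
  have hbw : b w = 0 := by rw [← h.tr hw, hf]
  have hw0 : w ≠ 0 := by
    rintro rfl
    have := h.eq_zero (hw.trans (by simp))
    rw [rk_eq_zero] at this; tauto
  have ht := h.tr2 huv hab
  rw [hf, zero_mul] at ht
  rw [huv, rk_mul]
  obtain ⟨p, q, hpq⟩ := h.rk (e + d n) (f n)
  rw [rk_add_left, map_add, hw, huv] at hpq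
  rcases rk_adj hw0 hb ⟨p, q, hpq⟩ with ⟨c, rfl⟩ | ⟨c, rfl⟩
  · simp [hbw]
  · simp [hba] at ht
    rcases ht with ht | ht
    · rw [ht, rk_smul_right, zero_smul, smul_zero]
    · simp [ht]

lemma step1' [TopologicalSpace.SeparableSpace H] (hH : ¬ FiniteDimensional ℂ H) (h : IsLoc Ψ)
    {e : H} {g : H →L[ℂ] ℂ} {a : H} {b : H →L[ℂ] ℂ} (ha0 : a ≠ 0) (hb : b ≠ 0) (he : e ≠ 0)
    (hab : Ψ (rk e g) = rk a b) :
    ∀ f, ∃ v, Ψ (rk e f) = rk a v := by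
  obtain ⟨g', hg'⟩ := exists_fun he
  obtain ⟨a', b', hab'⟩ := h.rk e g'
  have h1 := step1 hH h hg' hab'
  obtain ⟨v, hv⟩ := h1 g
  rw [hab] at hv
  obtain ⟨y, hy⟩ := exists_vec hb
  have h2 := congrArg (fun T : H →L[ℂ] H => T y) hv
  simp [hy] at h2
  have hv0 : v y ≠ 0 := by
    intro hv0; simp [hv0] at h2; exact ha0 h2
  intro f
  obtain ⟨v', hv'⟩ := h1 f
  refine ⟨(v y)⁻¹ • v', ?_⟩
  rw [hv', rk_smul_right, ← rk_smul_left, h2, smul_smul, inv_mul_cancel₀ hv0, one_smul]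

lemma exists_pair (hH : ¬ FiniteDimensional ℂ H) {e : H} {f : H →L[ℂ] ℂ} (he : f e = 1) :
    ∃ (x : H) (g : H →L[ℂ] ℂ), g e = 0 ∧ g x = 1 := by
  obtain ⟨x, hx⟩ : ∃ x : H, x - f x • e ≠ 0 := by
    by_contra! hc
    apply hH
    refine Module.finite_def.mpr ⟨{e}, ?_⟩
    rw [eq_top_iff]
    intro x _
    simp only [Finset.coe_singleton, Submodule.mem_span_singleton]
    exact ⟨f x, (sub_eq_zero.mp (hc x)).symm⟩
  obtain ⟨k, hk⟩ := exists_fun hx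
  refine ⟨x - f x • e, k - k e • f, by simp [he], ?_⟩
  rw [sub_apply, hk]
  simp [he]

lemma step2 [TopologicalSpace.SeparableSpace H] (hH : ¬ FiniteDimensional ℂ H) (h : IsLoc Ψ)
    {e : H} {f : H →L[ℂ] ℂ} {a : H} {b : H →L[ℂ] ℂ} (he : f e = 1) (hab : Ψ (rk e f) = rk a b) :
    ∀ x, ∃ u, Ψ (rk x f) = rk u b := by
  have hba : b a = 1 := by rw [← h.tr hab, he]
  have ha : a ≠ 0 := by rintro rfl; simp at hba
  have hb : b ≠ 0 := by rintro rfl; simp at hba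
  rcases rk_dich (Ψ.toLinearMap ∘ₗ rkL f) (fun x => h.rk x f) ha hb (x0 := e) hab with h1 | h1
  swap
  · exact h1
  exfalso
  obtain ⟨x, g, hg, hx⟩ := exists_pair hH he
  obtain ⟨v, hv⟩ := h1 x
  replace hv : Ψ (rk x f) = rk a v := hv
  obtain ⟨v', hv'⟩ := step1 hH h he hab g
  have h2 := h.tr hv'
  have h3 := h.tr2 hv hv'
  rw [← h2, hg, he, hx] at h3
  simp at h3

lemma step2' [TopologicalSpace.SeparableSpace H] (hH : ¬ FiniteDimensional ℂ H) (h : IsLoc Ψ)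
    {e : H} {g : H →L[ℂ] ℂ} {a : H} {b : H →L[ℂ] ℂ} (ha0 : a ≠ 0) (hb : b ≠ 0) (hg : g ≠ 0)
    (hab : Ψ (rk e g) = rk a b) :
    ∀ x, ∃ u, Ψ (rk x g) = rk u b := by
  obtain ⟨e', he'⟩ := exists_vec hg
  obtain ⟨a', b', hab'⟩ := h.rk e' g
  have h1 := step2 hH h he' hab'
  obtain ⟨u, hu⟩ := h1 e
  rw [hab] at hu
  obtain ⟨k, hk⟩ := exists_fun ha0
  have h2 : b = k u • b' := by
    ext y
    have h2 := congrArg (fun T : H →L[ℂ] H => k (T y)) hu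
    simp [hk] at h2
    simp [h2, mul_comm]
  have hv0 : k u ≠ 0 := by
    intro hv0; apply hb; ext y; rw [h2, hv0]; simp
  intro x
  obtain ⟨u', hu'⟩ := h1 x
  refine ⟨(k u)⁻¹ • u', ?_⟩
  rw [hu', rk_smul_left, ← rk_smul_right, h2, smul_smul, inv_mul_cancel₀ hv0, one_smul]

theorem local_aut [TopologicalSpace.SeparableSpace H] (hH : ¬ FiniteDimensional ℂ H)
    (h : IsLoc Ψ) : ∃ A : H ≃L[ℂ] H, ∀ T x, Ψ T (A x) = A (T x) := by
  obtain ⟨e, he0⟩ : ∃ e : H, e ≠ 0 := by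
    by_contra! hc
    apply hH
    have : Subsingleton H := ⟨fun x y => by rw [hc x, hc y]⟩
    infer_instance
  obtain ⟨g, hg⟩ := exists_fun he0
  obtain ⟨a, b, hab⟩ := h.rk e g
  have hba : b a = 1 := by rw [← h.tr hab, hg]
  have ha : a ≠ 0 := by rintro rfl; simp at hba
  have hb : b ≠ 0 := by rintro rfl; simp at hba
  have hg0 : g ≠ 0 := by rintro rfl; simp at hg
  let A : H →L[ℂ] H := (ContinuousLinearMap.apply ℂ H a).comp
    (Ψ.comp (ContinuousLinearMap.smulRightL ℂ H H g))
  let B : (H →L[ℂ] ℂ) → (H →L[ℂ] ℂ) := fun f => b.comp (Ψ (rk e f))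
  have hAdef : ∀ x, A x = Ψ (rk x g) a := fun x => rfl
  have hA : ∀ x, Ψ (rk x g) = rk (A x) b := by
    intro x
    obtain ⟨u, hu⟩ := step2 hH h hg hab x
    rw [hAdef, hu]
    simp [hba]
  have hB : ∀ f, Ψ (rk e f) = rk a (B f) := by
    intro f
    obtain ⟨v, hv⟩ := step1 hH h hg hab f
    have : B f = v := by
      ext y; simp [B, hv, hba]
    rw [this, hv]
  have hBadd : ∀ f f', B (f - f') = B f - B f' := by
    intro f f'
    ext y; simp [B, rk_sub_right]
  have hBA : ∀ f x, B f (A x) = f x := by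
    intro f x
    have := h.tr2 (hA x) (hB f)
    rw [hg, hba] at this
    simpa using this.symm
  have hBb : ∀ f, ‖B f‖ ≤ (‖b‖ * ‖Ψ‖ * ‖e‖) * ‖f‖ := by
    intro f
    have h1 : ‖rk e f‖ = ‖f‖ * ‖e‖ := ContinuousLinearMap.norm_smulRight_apply _ _
    calc ‖B f‖ ≤ ‖b‖ * ‖Ψ (rk e f)‖ := ContinuousLinearMap.opNorm_comp_le _ _
      _ ≤ ‖b‖ * (‖Ψ‖ * ‖rk e f‖) := by gcongr; exact Ψ.le_opNorm _
      _ = _ := by rw [h1]; ring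
  have hA0 : ∀ x, x ≠ 0 → A x ≠ 0 := by
    intro x hx hAx
    obtain ⟨k, hk⟩ := exists_fun hx
    have := hBA k x
    simp [hAx, hk] at this
  have hB0 : ∀ f, f ≠ 0 → B f ≠ 0 := by
    intro f hf hBf
    obtain ⟨y, hy⟩ := exists_vec hf
    have := hBA f y
    simp [hBf, hy] at this
  have hform1 : ∀ x f, f x ≠ 0 → Ψ (rk x f) = rk (A x) (B f) := by
    intro x f hfx
    have hx : x ≠ 0 := by rintro rfl; simp at hfx
    have hf : f ≠ 0 := by rintro rfl; simp at hfx
    obtain ⟨v, hv⟩ := step1' hH h (hA0 x hx) hb hx (hA x) f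
    obtain ⟨u, hu⟩ := step2' hH h ha (hB0 f hf) hf (hB f) x
    obtain ⟨γ, hγ⟩ := rk_common (hB0 f hf) (hv.symm.trans hu)
    rw [← hv, ← rk_smul_left] at hγ
    have := h.tr hγ
    rw [map_smul, hBA, smul_eq_mul] at this
    have h1 : γ = 1 := by
      field_simp at this
      exact this.symm
    rw [hγ, h1, one_smul]
  have hform : ∀ x f, Ψ (rk x f) = rk (A x) (B f) := by
    intro x f
    by_cases hfx : f x = 0
    · by_cases hx : x = 0
      · simp [hx]
      obtain ⟨k, hk⟩ := exists_fun hx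
      have h1 := hform1 x (f + k) (by simp [hfx, hk])
      have h2 := hform1 x k (by simp [hk])
      have h3 : f = (f + k) - k := by abel
      rw [h3, rk_sub_right, map_sub, h1, h2, hBadd, rk_sub_right]
    · exact hform1 x f hfx
  set C := ‖b‖ * ‖Ψ‖ * ‖e‖ with hC
  have hanti : AntilipschitzWith C.toNNReal A := by
    apply A.antilipschitz_of_bound
    intro x
    obtain ⟨k, hk1, hk⟩ := exists_dual_vector'' ℂ x
    rw [Real.coe_toNNReal _ (by positivity)]
    have h1 : ‖x‖ = ‖B k (A x)‖ := by rw [hBA, hk]; simp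
    rw [h1]
    calc ‖B k (A x)‖ ≤ ‖B k‖ * ‖A x‖ := (B k).le_opNorm _
      _ ≤ (C * ‖k‖) * ‖A x‖ := by gcongr; exact hBb k
      _ ≤ (C * 1) * ‖A x‖ := by gcongr
      _ = _ := by ring
  have hcl : IsClosed (Set.range A) := hanti.isClosed_range A.uniformContinuous
  have hsurj : Function.Surjective A := by
    by_contra hns
    obtain ⟨y, hy⟩ : ∃ y, y ∉ Set.range A := by
      by_contra! hc; exact hns hc
    have hcl' : IsClosed ((LinearMap.range A.toLinearMap : Submodule ℂ H) : Set H) := by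
      rw [LinearMap.coe_range]; exact hcl
    obtain ⟨ξ, hξ1, hξ2⟩ : ∃ ξ : H →L[ℂ] ℂ, (∀ x, ξ (A x) = 0) ∧ ξ ≠ 0 := by
      have : CompleteSpace (LinearMap.range A.toLinearMap) := hcl'.completeSpace_coe
      have h1 : (LinearMap.range A.toLinearMap)ᗮ ≠ ⊥ := by
        rw [Ne, Submodule.orthogonal_eq_bot_iff]
        intro ht
        exact hns (LinearMap.range_eq_top.mp ht)
      obtain ⟨v, hv, hv0⟩ := Submodule.exists_mem_ne_zero_of_ne_bot h1
      refine ⟨innerSL ℂ v, fun x => ?_, ?_⟩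
      · exact Submodule.inner_left_of_mem_orthogonal (LinearMap.mem_range_self A.toLinearMap x) hv
      · intro h0
        have := congrArg (fun k : H →L[ℂ] ℂ => k v) h0
        simp at this
        exact hv0 this
    obtain ⟨K, d, f, hK, hf, hT⟩ := exists_K hH he0
    have := kill h hK hT (rk e ξ) (fun n => by rw [hform, rk_mul, hξ1, zero_smul])
    rw [rk_eq_zero] at this
    tauto
  let A' : H ≃L[ℂ] H := ContinuousLinearEquiv.ofBijective A
    (LinearMap.ker_eq_bot.mpr hanti.injective) (LinearMap.range_eq_top.mpr hsurj)
  have hinv : ∀ T, IsUnit T → ∀ x, Ψ T (A x) = A (T x) := by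
    intro T hT x
    have hT' := (h.isUnit T).mpr hT
    obtain ⟨S, h1, h2⟩ := isUnit_iff_exists.mp hT
    obtain ⟨S', h1', h2'⟩ := isUnit_iff_exists.mp hT'
    have key : ∀ z, S' (A z) = A (S z) := by
      intro z
      obtain ⟨z', hz'⟩ := hsurj (S' (A z))
      rw [← hz']
      congr 1
      by_contra hne
      obtain ⟨k, hk⟩ := exists_fun (sub_ne_zero.mpr hne)
      have := h.star (hform z k) h1 h2 rfl h1' h2'
      rw [← hz', hBA] at this
      simp [this] at hk
    have e1 : S (T x) = x := congrArg (fun T : H →L[ℂ] H => T x) h2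
    have e2 := key (T x)
    rw [e1] at e2
    rw [← e2]
    exact congrArg (fun R : H →L[ℂ] H => R (A (T x))) h1'
  refine ⟨A', fun T x => ?_⟩
  change Ψ T (A x) = A (T x)
  obtain ⟨z, hz⟩ : ∃ z : ℂ, IsUnit (T + z • (1 : H →L[ℂ] H)) := by
    have : Nontrivial H := ⟨e, 0, he0⟩
    refine ⟨(‖T‖ + 1 : ℝ), ?_⟩
    have h1 : ((-(‖T‖ + 1) : ℝ) : ℂ) ∈ resolventSet ℂ T := by
      apply spectrum.mem_resolventSet_of_norm_lt
      rw [Complex.norm_real, Real.norm_eq_abs, abs_neg, abs_of_pos (by positivity)]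
      linarith
    rw [spectrum.mem_resolventSet_iff, ← IsUnit.neg_iff] at h1
    convert h1 using 1
    rw [Algebra.algebraMap_eq_smul_one, neg_sub, Complex.ofReal_neg, neg_smul, sub_neg_eq_add]
  have := hinv _ hz x
  rw [map_add, map_smul, h.one] at this
  simpa using this
end P2

section P3
open Filter Topology

/-- injective function in `C₀(ℝ,ℂ)` -/
noncomputable def hh : C₀(ℝ, ℂ) where
  toFun y := (1 - Complex.I * y)⁻¹
  continuous_toFun := by
    refine Continuous.inv₀ (by fun_prop) fun y h => ?_
    have := congrArg Complex.re h
    simp at this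
  zero_at_infty' := by
    apply tendsto_inv₀_cobounded.comp
    rw [← tendsto_norm_atTop_iff_cobounded]
    refine tendsto_atTop_mono (f := fun y : ℝ => ‖y‖) (fun y => ?_) tendsto_norm_cocompact_atTop
    have := Complex.abs_im_le_norm (1 - Complex.I * y)
    simpa using this

lemma hh_apply (y : ℝ) : hh y = (1 - Complex.I * y)⁻¹ := rfl
lemma hh_inv (y : ℝ) : y = - ((hh y)⁻¹).im := by simp [hh_apply]
lemma hh_inj {x y : ℝ} (h : hh x = hh y) : x = y := by rw [hh_inv x, hh_inv y, h]
lemma hh_ne (y : ℝ) : hh y ≠ 0 := by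
  intro h
  rw [hh_apply, inv_eq_zero] at h
  have := congrArg Complex.re h
  simp at this

/-- tent function: one near `q`, zero outside the ball of radius `2 * r`. -/
noncomputable def bump (q r : ℝ) (hr : 0 < r) : C₀(ℝ, ℂ) where
  toFun y := ((min 1 (max 0 (2 - |y - q| / r)) : ℝ) : ℂ)
  continuous_toFun := by fun_prop
  zero_at_infty' := by
    apply tendsto_const_nhds.congr'
    have h1 : Tendsto (fun y : ℝ => |y - q|) (cocompact ℝ) atTop := by
      refine tendsto_atTop_mono (f := fun y : ℝ => ‖y‖ - |q|) (fun y => ?_) 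
        (tendsto_atTop_add_const_right _ _ tendsto_norm_cocompact_atTop)
      exact abs_sub_abs_le_abs_sub y q
    filter_upwards [h1.eventually_ge_atTop (2 * r)] with y hy
    have : 2 - |y - q| / r ≤ 0 := by
      rw [sub_nonpos, le_div_iff₀ hr]; exact hy
    rw [max_eq_left this]
    simp

lemma bump_eq (q r : ℝ) (hr : 0 < r) (y : ℝ) : ∃ t : ℝ, bump q r hr y = t ∧ 0 ≤ t ∧ t ≤ 1 :=
  ⟨_, rfl, le_min zero_le_one (le_max_left _ _), min_le_left _ _⟩
lemma bump_one (q r : ℝ) (hr : 0 < r) (y : ℝ) (hy : |y - q| ≤ r) : bump q r hr y = 1 := by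
  have : 1 ≤ 2 - |y - q| / r := by
    have : |y - q| / r ≤ 1 := by rwa [div_le_one hr]
    linarith
  change ((min 1 (max 0 (2 - |y - q| / r)) : ℝ) : ℂ) = 1
  rw [max_eq_right (by linarith), min_eq_left this]; simp
lemma bump_zero (q r : ℝ) (hr : 0 < r) (y : ℝ) (hy : 2 * r ≤ |y - q|) : bump q r hr y = 0 := by
  have : 2 - |y - q| / r ≤ 0 := by
    rw [sub_nonpos, le_div_iff₀ hr]; exact hy
  change ((min 1 (max 0 (2 - |y - q| / r)) : ℝ) : ℂ) = 0
  rw [max_eq_left this]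
  simp

/-- real part -/
noncomputable def reP (g : C₀(ℝ, ℂ)) : C₀(ℝ, ℂ) where
  toFun y := ((g y).re : ℂ)
  continuous_toFun := by have := g.continuous; fun_prop
  zero_at_infty' := by
    have h : Continuous fun z : ℂ => (z.re : ℂ) := by fun_prop
    have := (h.tendsto 0).comp g.zero_at_infty'
    simp only [Function.comp_def] at this
    simpa using this
noncomputable def imP (g : C₀(ℝ, ℂ)) : C₀(ℝ, ℂ) where
  toFun y := ((g y).im : ℂ)
  continuous_toFun := by have := g.continuous; fun_prop
  zero_at_infty' := by
    have h : Continuous fun z : ℂ => (z.im : ℂ) := by fun_prop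
    have := (h.tendsto 0).comp g.zero_at_infty'
    simp only [Function.comp_def] at this
    simpa using this
lemma reP_apply (g : C₀(ℝ, ℂ)) (y : ℝ) : reP g y = ((g y).re : ℂ) := rfl
lemma imP_apply (g : C₀(ℝ, ℂ)) (y : ℝ) : imP g y = ((g y).im : ℂ) := rfl
lemma re_im (g : C₀(ℝ, ℂ)) : g = reP g + Complex.I • imP g := by
  ext y
  simp [reP_apply, imP_apply]
  rw [mul_comm, Complex.re_add_im]

theorem eval_of_range (l : C₀(ℝ, ℂ) →ₗ[ℂ] ℂ) (hl : ∀ g, l g = 0 ∨ ∃ y, l g = g y) (h0 : l ≠ 0) :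
    ∃ q, ∀ g, l g = g q := by
  have hre : ∀ g : C₀(ℝ, ℂ), (∀ y, (g y).im = 0) → (l g).im = 0 := by
    intro g hg
    rcases hl g with h | ⟨y, h⟩ <;> simp [h, hg]
  have hsq : ∀ g : C₀(ℝ, ℂ), (∀ y, (g y).im = 0) → l (g * g) = l g * l g := by
    intro g hg
    have h1 := hre g hg
    have h2 := hre (g * g) (fun y => by simp [hg])
    have h3 : ∃ t : ℂ, t.im = 0 ∧ l g + Complex.I * l (g * g) = t + Complex.I * (t * t) := by
      rcases hl (g + Complex.I • (g * g)) with h | ⟨y, h⟩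
      · exact ⟨0, by simp, by simpa using h⟩
      · exact ⟨g y, hg y, by simpa using h⟩
    obtain ⟨t, ht, h3⟩ := h3
    have h4 := congrArg Complex.re h3
    have h5 := congrArg Complex.im h3
    simp [h1, h2, ht] at h4 h5
    apply Complex.ext <;> simp [h1, h2, h4, h5]
  have hfam : ∀ u : Fin 4 → C₀(ℝ, ℂ), (∀ i y, (u i y).im = 0) → l (u 0) ≠ 0 →
      ∃ y, ∀ i, l (u i) = u i y := by
    intro u hu hu0
    have hr : ∀ i, ∃ r : ℝ, l (u i) = r := fun i =>
      ⟨(l (u i)).re, Complex.ext (by simp) (by simp [hre _ (hu i)])⟩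
    choose c hc using hr
    let F : C₀(ℝ, ℂ) := ∑ i, (u i * u i - (2 * c i : ℂ) • u i)
    have hF : l F = ((- ∑ i, (c i)^2 : ℝ) : ℂ) := by
      simp only [F, map_sum, map_sub, map_smul, hsq _ (hu _), hc, smul_eq_mul]
      rw [← Finset.sum_neg_distrib]
      push_cast
      exact Finset.sum_congr rfl fun i _ => by ring
    have hc0 : c 0 ≠ 0 := by
      intro h; rw [hc, h] at hu0; simp at hu0
    have hpos : 0 < ∑ i, (c i)^2 := 
      lt_of_lt_of_le (by positivity) (Finset.single_le_sum (f := fun i => (c i)^2)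
        (fun i _ => sq_nonneg _) (Finset.mem_univ 0))
    rcases hl F with h | ⟨y, h⟩
    · rw [hF] at h
      norm_cast at h
      linarith
    · refine ⟨y, ?_⟩
      have hur : ∀ i, u i y = (((u i y).re : ℝ) : ℂ) := fun i =>
        Complex.ext (by simp) (by simp [hu])
      have hFy : F y = ((∑ i, ((u i y).re ^ 2 - 2 * c i * (u i y).re) : ℝ) : ℂ) := by
        simp only [F, Fin.sum_univ_four]
        simp only [ZeroAtInftyContinuousMap.add_apply, ZeroAtInftyContinuousMap.sub_apply,
          ZeroAtInftyContinuousMap.mul_apply, ZeroAtInftyContinuousMap.smul_apply]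
        rw [hur 0, hur 1, hur 2, hur 3]
        push_cast
        simp
        ring
      rw [hF, hFy] at h
      norm_cast at h
      have hz : ∑ i, ((u i y).re - c i)^2 = 0 := by
        simp only [Fin.sum_univ_four] at h ⊢
        linarith
      rw [Finset.sum_eq_zero_iff_of_nonneg (fun i _ => sq_nonneg _)] at hz
      intro i
      have := hz i (Finset.mem_univ _)
      have := pow_eq_zero_iff (two_ne_zero) |>.mp this
      rw [hc, hur i]
      congr 1
      linarith
  obtain ⟨u0, hu0, hlu0⟩ : ∃ u0 : C₀(ℝ, ℂ), (∀ y, (u0 y).im = 0) ∧ l u0 ≠ 0 := by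
    by_contra! hc
    apply h0
    ext g
    rw [re_im g, map_add, map_smul, hc (reP g) (fun y => by simp [reP_apply]),
      hc (imP g) (fun y => by simp [imP_apply])]
    simp
  have hq : ∀ u : C₀(ℝ, ℂ), (∀ y, (u y).im = 0) → ∃ y, l u = u y ∧ l hh = hh y := by
    intro u hu
    obtain ⟨y, hy⟩ := hfam ![u0, reP hh, imP hh, u] (by
      intro i y
      fin_cases i <;> simp [hu0, hu, reP_apply, imP_apply]) hlu0
    refine ⟨y, hy 3, ?_⟩
    have h1 := hy 1
    have h2 := hy 2
    simp at h1 h2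
    rw [re_im hh, map_add, map_smul, h1, h2]
    simp
  obtain ⟨q, -, hq0⟩ := hq 0 (by simp)
  have hq' : ∀ u : C₀(ℝ, ℂ), (∀ y, (u y).im = 0) → l u = u q := by
    intro u hu
    obtain ⟨y, h1, h2⟩ := hq u hu
    rw [h1, hh_inj (hq0.symm.trans h2)]
  refine ⟨q, fun g => ?_⟩
  have := re_im g
  rw [re_im g, map_add, map_smul, hq' (reP g) (fun y => by simp [reP_apply]),
      hq' (imP g) (fun y => by simp [imP_apply])]
  simp

end P3

section P4
open Filter Topology
variable {H : Type*} [NormedAddCommGroup H] [InnerProductSpace ℂ H] 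

/-- `y ↦ g y • T` -/
noncomputable def sm (g : C₀(ℝ, ℂ)) (T : H →L[ℂ] H) : C₀(ℝ, H →L[ℂ] H) where
  toFun y := g y • T
  continuous_toFun := by have := g.continuous; fun_prop
  zero_at_infty' := by
    have := (g.zero_at_infty').smul_const T
    rw [zero_smul] at this
    exact this

@[simp] lemma sm_apply (g : C₀(ℝ, ℂ)) (T : H →L[ℂ] H) (y : ℝ) : sm g T y = g y • T := rfl

/-- compression by a functional -/
noncomputable def cL (L : (H →L[ℂ] H) →L[ℂ] ℂ) (f : C₀(ℝ, H →L[ℂ] H)) : C₀(ℝ, ℂ) where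
  toFun y := L (f y)
  continuous_toFun := by have := f.continuous; fun_prop
  zero_at_infty' := by
    have := (L.continuous.tendsto 0).comp f.zero_at_infty'
    rw [map_zero] at this
    exact this

lemma cL_apply (L : (H →L[ℂ] H) →L[ℂ] ℂ) (f : C₀(ℝ, H →L[ℂ] H)) (y : ℝ) :
  cL L f y = L (f y) := rfl

lemma factor (f : C₀(ℝ, H →L[ℂ] H)) : ∃ (k : C₀(ℝ, ℂ)) (f' : C₀(ℝ, H →L[ℂ] H)),
    f = sm k 1 * f' ∧ ∀ y, f y = 0 → k y = 0 := by
  have hn : Tendsto (fun y => ‖f y‖) (cocompact ℝ) (𝓝 0) := by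
    have := f.zero_at_infty'
    rw [tendsto_zero_iff_norm_tendsto_zero] at this
    exact this
  have hs : Tendsto (fun y => √‖f y‖) (cocompact ℝ) (𝓝 0) := by
    have := (Real.continuous_sqrt.tendsto 0).comp hn
    rw [Real.sqrt_zero] at this
    exact this
  have hfc : Continuous fun y => f y := f.continuous
  have hsc : Continuous fun y => √‖f y‖ := by fun_prop
  have hnorm : ∀ y, ‖((√‖f y‖)⁻¹ : ℂ) • f y‖ = √‖f y‖ := by
    intro y
    rw [norm_smul, norm_inv, Complex.norm_real, Real.norm_eq_abs, abs_of_nonneg (Real.sqrt_nonneg _)]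
    by_cases h : ‖f y‖ = 0
    · simp [h]
    · have h1 : √‖f y‖ ≠ 0 := by
        rw [Real.sqrt_ne_zero (norm_nonneg _)]; exact h
      field_simp
      rw [Real.sq_sqrt (norm_nonneg _)]
  let k : C₀(ℝ, ℂ) := ⟨⟨fun y => ((√‖f y‖ : ℝ) : ℂ), by fun_prop⟩, by
    have := (Complex.continuous_ofReal.tendsto 0).comp hs
    rw [Complex.ofReal_zero] at this
    exact this⟩
  let f' : C₀(ℝ, H →L[ℂ] H) := ⟨⟨fun y => ((√‖f y‖)⁻¹ : ℂ) • f y, by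
    rw [continuous_iff_continuousAt]
    intro y
    by_cases h : ‖f y‖ = 0
    · have h0 : f y = 0 := norm_eq_zero.mp h
      rw [ContinuousAt, h0, smul_zero, tendsto_zero_iff_norm_tendsto_zero]
      simp only [hnorm]
      have := hsc.tendsto y
      rwa [h, Real.sqrt_zero] at this
    · have h1 : ((√‖f y‖ : ℝ) : ℂ) ≠ 0 := by
        rw [Complex.ofReal_ne_zero, Real.sqrt_ne_zero (norm_nonneg _)]; exact h
      have h2 : ContinuousAt (fun y => ((√‖f y‖ : ℝ) : ℂ)) y :=
        (Complex.continuous_ofReal.comp hsc).continuousAt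
      exact (h2.inv₀ h1).smul hfc.continuousAt⟩, by
    rw [tendsto_zero_iff_norm_tendsto_zero]
    refine hs.congr fun y => (hnorm y).symm⟩
  refine ⟨k, f', ?_, ?_⟩
  · ext1 y
    change f y = (((√‖f y‖ : ℝ) : ℂ) • (1 : H →L[ℂ] H)) * (((√‖f y‖)⁻¹ : ℂ) • f y)
    rw [smul_mul_smul_comm, one_mul]
    by_cases h : ‖f y‖ = 0
    · have h0 : f y = 0 := norm_eq_zero.mp h
      simp [h0]
    · have h1 : ((√‖f y‖ : ℝ) : ℂ) ≠ 0 := by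
        rw [Complex.ofReal_ne_zero, Real.sqrt_ne_zero (norm_nonneg _)]; exact h
      rw [mul_inv_cancel₀ h1, one_smul]
  · intro y hy
    change ((√‖f y‖ : ℝ) : ℂ) = 0
    simp [hy]

lemma center_scalar {R : H →L[ℂ] H} (h : ∀ T, R * T = T * R) {e : H} {g : H →L[ℂ] ℂ}
    (he : g e = 1) : R = g (R e) • 1 := by
  ext x
  have := congrArg (fun T : H →L[ℂ] H => T e) (h (rk x g))
  simp [he] at this
  simp [this]

lemma sm_add (g g' : C₀(ℝ, ℂ)) (T : H →L[ℂ] H) : sm (g + g') T = sm g T + sm g' T := by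
  ext1 y; simp [add_smul]
lemma sm_smul (c : ℂ) (g : C₀(ℝ, ℂ)) (T : H →L[ℂ] H) : sm (c • g) T = c • sm g T := by
  ext1 y; simp [mul_smul]
lemma sm_mul (g g' : C₀(ℝ, ℂ)) : sm (g * g') (1 : H →L[ℂ] H) = sm g 1 * sm g' 1 := by
  ext1 y; simp [smul_smul, mul_comm]

/-- the point map of an automorphism -/
lemma pointmap {S : C₀(ℝ, H →L[ℂ] H) → C₀(ℝ, H →L[ℂ] H)} (hS : IsAlgebraAutomorphism S)
    {e : H} {k : H →L[ℂ] ℂ} (hek : k e = 1) :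
    ∃ φ : ℝ → ℝ, Continuous φ ∧ (∀ g x, S (sm g 1) x = g (φ x) • 1) ∧
      (∀ f x, f (φ x) = 0 → S f x = 0) := by
  obtain ⟨hlin, hmul, hinj, hsurj⟩ := hS
  have he0 : e ≠ 0 := by rintro rfl; simp at hek
  have : Nontrivial H := ⟨e, 0, he0⟩
  let L : (H →L[ℂ] H) →L[ℂ] ℂ := k.comp (ContinuousLinearMap.apply ℂ H e)
  have hL : ∀ T, L T = k (T e) := fun T => rfl
  have hcen : ∀ g x, S (sm g 1) x = L (S (sm g 1) x) • 1 := by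
    intro g x
    refine center_scalar (fun T => ?_) hek
    obtain ⟨f, hf⟩ := hsurj (sm (bump x 1 one_pos) T)
    have h1 : sm g 1 * f = f * sm g 1 := by
      ext1 y; simp
    have h2 := congrArg (fun F => S F x) h1
    simp only [hmul, hf, ZeroAtInftyContinuousMap.mul_apply, sm_apply] at h2
    rwa [bump_one x 1 one_pos x (by simp), one_smul] at h2
  have hpt : ∀ x, ∃ q, ∀ g, L (S (sm g 1) x) = g q := by
    intro x
    let l : C₀(ℝ, ℂ) →ₗ[ℂ] ℂ :=
      { toFun := fun g => L (S (sm g 1) x)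
        map_add' := fun g g' => by simp [sm_add, hlin.map_add]
        map_smul' := fun c g => by simp [sm_smul, hlin.map_smul] }
    have hlm : ∀ g g', l (g * g') = l g * l g' := by
      intro g g'
      change L (S (sm (g * g') 1) x) = L (S (sm g 1) x) * L (S (sm g' 1) x)
      rw [sm_mul, hmul, ZeroAtInftyContinuousMap.mul_apply, hcen g', mul_smul_comm, mul_one, map_smul,
        smul_eq_mul, mul_comm]
      congr 1
      rw [hcen g']
      simp [hL, hek]
    apply eval_of_range l
    · intro g
      by_contra! hc
      obtain ⟨h0, h1⟩ := hc
      have hd : ∀ y, l g - g y ≠ 0 := fun y => sub_ne_zero.mpr (h1 y)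
      have hgc : Continuous fun y => g y := g.continuous
      let m : C₀(ℝ, ℂ) := ⟨⟨fun y => g y / (l g - g y), by
        exact hgc.div (by fun_prop) hd⟩, by
          have h2 : Tendsto (fun y => g y) (cocompact ℝ) (𝓝 0) := g.zero_at_infty'
          have := h2.div (tendsto_const_nhds (x := l g) |>.sub h2) (by simpa using h0)
          rw [zero_div] at this
          exact this⟩
      have hm : g = l g • m - g * m := by
        ext y
        change g y = l g * (g y / (l g - g y)) - g y * (g y / (l g - g y))
        have := hd y
        field_simp
      have := congrArg l hm
      rw [map_sub, map_smul, hlm, smul_eq_mul, sub_self] at this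
      exact h0 this
    · intro h0
      obtain ⟨f, hf⟩ := hsurj (sm (bump x 1 one_pos) 1)
      obtain ⟨g, f', hgf, -⟩ := factor f
      have h1 := congrArg (fun F => F x) hf
      rw [hgf] at h1
      simp only [hmul, ZeroAtInftyContinuousMap.mul_apply, sm_apply] at h1
      have h2 : L (S (sm g 1) x) = 0 := congrArg (fun l => l g) h0
      rw [hcen, h2, bump_one x 1 one_pos x (by simp)] at h1
      simp at h1
  choose φ hφ using hpt
  have hφ' : ∀ g x, S (sm g 1) x = g (φ x) • 1 := fun g x => by rw [hcen, hφ]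
  refine ⟨φ, ?_, hφ', ?_⟩
  · have h1 : ∀ x, φ x = - ((cL L (S (sm hh 1)) x)⁻¹).im := by
      intro x
      rw [cL_apply, hφ, ← hh_inv]
    rw [funext h1]
    have h2 : Continuous fun x => cL L (S (sm hh 1)) x := (cL L (S (sm hh 1))).continuous
    have h3 : ∀ x, cL L (S (sm hh 1)) x ≠ 0 := by
      intro x; rw [cL_apply, hφ]; exact hh_ne _
    exact (Complex.continuous_im.comp (h2.inv₀ h3)).neg
  · intro f x hf
    obtain ⟨g, f', hgf, hg⟩ := factor f
    rw [hgf, hmul, ZeroAtInftyContinuousMap.mul_apply, hφ', hg _ hf]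
    simp

theorem structS {S : C₀(ℝ, H →L[ℂ] H) → C₀(ℝ, H →L[ℂ] H)} (hS : IsAlgebraAutomorphism S)
    {e : H} {k : H →L[ℂ] ℂ} (hek : k e = 1) :
    ∃ φ : ℝ ≃ₜ ℝ, ∀ x, ∃ τ : (H →L[ℂ] H) ≃ₐ[ℂ] (H →L[ℂ] H), ∀ f, S f x = τ (f (φ x)) := by
  have he0 : e ≠ 0 := by rintro rfl; simp at hek
  have : Nontrivial H := ⟨e, 0, he0⟩
  obtain ⟨φ, hφc, hφ1, hφ2⟩ := pointmap hS hek
  obtain ⟨hlin, hmul, hbij⟩ := hS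
  let E := Equiv.ofBijective S hbij
  let S' : C₀(ℝ, H →L[ℂ] H) → C₀(ℝ, H →L[ℂ] H) := E.symm
  have hSS' : ∀ f, S (S' f) = f := fun f => E.apply_symm_apply f
  have hS'S : ∀ f, S' (S f) = f := fun f => E.symm_apply_apply f
  have hS' : IsAlgebraAutomorphism S' := by
    refine ⟨⟨fun a b => ?_, fun c a => ?_⟩, fun a b => ?_, E.symm.bijective⟩
    · apply hbij.1; rw [hlin.map_add, hSS', hSS', hSS']
    · apply hbij.1; rw [hlin.map_smul, hSS', hSS']
    · apply hbij.1; rw [hmul, hSS', hSS', hSS']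
  obtain ⟨ψ, hψc, hψ1, hψ2⟩ := pointmap hS' hek
  let L : (H →L[ℂ] H) →L[ℂ] ℂ := k.comp (ContinuousLinearMap.apply ℂ H e)
  have hL1 : L 1 = 1 := by simp [L, hek]
  have smul_one_inj : ∀ c d : ℂ, c • (1 : H →L[ℂ] H) = d • 1 → c = d := by
    intro c d h
    have := congrArg L h
    simpa [hL1] using this
  have comp : ∀ (S S' : C₀(ℝ, H →L[ℂ] H) → C₀(ℝ, H →L[ℂ] H)) (φ ψ : ℝ → ℝ),
      (∀ f, S (S' f) = f) → (∀ g x, S (sm g 1) x = g (φ x) • 1) →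
      (∀ g x, S' (sm g 1) x = g (ψ x) • 1) → ∀ x, ψ (φ x) = x := by
    intro S S' φ ψ hs h1 h2 x
    have h3 : S' (sm hh 1) = sm (cL L (S' (sm hh 1))) 1 := by
      ext1 y
      rw [sm_apply, cL_apply, h2, map_smul, hL1]; simp
    have h4 := hs (sm hh 1)
    rw [h3] at h4
    have h5 := congrArg (fun F => F x) h4
    simp only [h1, sm_apply] at h5
    have h6 := smul_one_inj _ _ h5
    rw [cL_apply, h2, map_smul, hL1, smul_eq_mul, mul_one] at h6
    exact hh_inj h6
  have hψφ := comp S S' φ ψ hSS' hφ1 hψ1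
  have hφψ := comp S' S ψ φ hS'S hψ1 hφ1
  refine ⟨⟨⟨φ, ψ, hψφ, hφψ⟩, hφc, hψc⟩, fun x => ?_⟩
  change ∃ τ : (H →L[ℂ] H) ≃ₐ[ℂ] (H →L[ℂ] H), ∀ f, S f x = τ (f (φ x))
  have hdep : ∀ f f' : C₀(ℝ, H →L[ℂ] H), f (φ x) = f' (φ x) → S f x = S f' x := by
    intro f f' h
    have h1 := hφ2 (f - f') x (by simp [h])
    rw [hlin.map_sub] at h1
    simpa [sub_eq_zero] using h1
  let G := bump (φ x) 1 one_pos
  have hG : G (φ x) = 1 := bump_one _ _ _ _ (by simp)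
  have hτ : ∀ f, S f x = S (sm G (f (φ x))) x := fun f => hdep _ _ (by simp [hG])
  let t : (H →L[ℂ] H) →ₗ[ℂ] (H →L[ℂ] H) :=
    { toFun := fun T => S (sm G T) x
      map_add' := fun T T' => by
        rw [← ZeroAtInftyContinuousMap.add_apply, ← hlin.map_add]
        exact hdep _ _ (by simp)
      map_smul' := fun c T => by
        simp only [RingHom.id_apply]
        rw [← ZeroAtInftyContinuousMap.smul_apply, ← hlin.map_smul]
        exact hdep _ _ (by simp only [ZeroAtInftyContinuousMap.smul_apply, sm_apply, hG, one_smul]) }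
  have tm : ∀ T T', t (T * T') = t T * t T' := by
    intro T T'
    change S (sm G (T * T')) x = S (sm G T) x * S (sm G T') x
    rw [← ZeroAtInftyContinuousMap.mul_apply, ← hmul]
    exact hdep _ _ (by simp [hG])
  have tsurj : Function.Surjective t := by
    intro T
    obtain ⟨f, hf⟩ := hbij.2 (sm (bump x 1 one_pos) T)
    refine ⟨f (φ x), ?_⟩
    change S (sm G (f (φ x))) x = T
    rw [← hτ, hf, sm_apply, bump_one _ _ _ _ (by simp), one_smul]
  have tinj : Function.Injective t := by
    rw [← LinearMap.ker_eq_bot, LinearMap.ker_eq_bot']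
    intro T hT
    have h1 := hψ2 (S (sm G T)) (φ x) (by rw [hψφ]; exact hT)
    rw [hS'S, sm_apply, hG, one_smul] at h1
    exact h1
  have t1 : t 1 = 1 := by
    obtain ⟨T, hT⟩ := tsurj 1
    have := tm T 1
    rw [mul_one, hT, one_mul] at this
    exact this.symm
  refine ⟨AlgEquiv.ofBijective (AlgHom.ofLinearMap t t1 tm) ⟨tinj, tsurj⟩, fun f => ?_⟩
  exact hτ f

end P4

section P5
open Filter Topology
variable {H : Type*} [NormedAddCommGroup H] [InnerProductSpace ℂ H]

lemma c0_le (f : C₀(ℝ, H →L[ℂ] H)) (y : ℝ) : ‖f y‖ ≤ ‖f‖ := by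
  rw [← ZeroAtInftyContinuousMap.norm_toBCF_eq_norm]
  exact f.toBCF.norm_coe_le_norm y

lemma c0_norm_le_s8 (f : C₀(ℝ, H →L[ℂ] H)) {C : ℝ} (hC : 0 ≤ C) (h : ∀ y, ‖f y‖ ≤ C) : ‖f‖ ≤ C := by
  rw [← ZeroAtInftyContinuousMap.norm_toBCF_eq_norm]
  exact (BoundedContinuousFunction.norm_le hC).mpr h

/-- the similarity clause extracted from local automorphisms -/
def PtLoc (Φ : C₀(ℝ, H →L[ℂ] H) →L[ℂ] C₀(ℝ, H →L[ℂ] H)) : Prop :=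
  ∀ f x, ∃ p, ∃ τ : (H →L[ℂ] H) ≃ₐ[ℂ] (H →L[ℂ] H), Φ f x = τ (f p)

variable {Φ : C₀(ℝ, H →L[ℂ] H) →L[ℂ] C₀(ℝ, H →L[ℂ] H)}

lemma scalar_inj [Nontrivial H] {c d : ℂ} (h : c • (1 : H →L[ℂ] H) = d • 1) : c = d :=
  smul_left_injective ℂ (one_ne_zero) h

lemma scalar_part [Nontrivial H] (h : PtLoc Φ) (x : ℝ) :
    ∃ q, ∀ g, Φ (sm g 1) x = g q • 1 := by
  obtain ⟨e, he⟩ := exists_ne (0 : H)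
  obtain ⟨k, hk⟩ := exists_fun he
  let L : (H →L[ℂ] H) →L[ℂ] ℂ := k.comp (ContinuousLinearMap.apply ℂ H e)
  have hL1 : L 1 = 1 := by simp [L, hk]
  have hsc : ∀ g, ∃ p, Φ (sm g 1) x = g p • 1 := by
    intro g
    obtain ⟨p, τ, hp⟩ := h (sm g 1) x
    exact ⟨p, by rw [hp, sm_apply, map_smul, map_one]⟩
  let l : C₀(ℝ, ℂ) →ₗ[ℂ] ℂ :=
    { toFun := fun g => L (Φ (sm g 1) x)
      map_add' := fun g g' => by simp [sm_add]
      map_smul' := fun c g => by simp [sm_smul] }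
  have hl : ∀ g, ∃ y, l g = g y := by
    intro g
    obtain ⟨p, hp⟩ := hsc g
    exact ⟨p, by change L (Φ (sm g 1) x) = _; rw [hp, map_smul, hL1]; simp⟩
  obtain ⟨q, hq⟩ := eval_of_range l (fun g => Or.inr (hl g)) (by
    intro h0
    obtain ⟨y, hy⟩ := hl hh
    rw [h0] at hy
    exact hh_ne y hy.symm)
  refine ⟨q, fun g => ?_⟩
  obtain ⟨p, hp⟩ := hsc g
  have : l g = g p := by change L (Φ (sm g 1) x) = _; rw [hp, map_smul, hL1]; simp
  rw [hp, ← this, hq]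

variable [CompleteSpace H]

lemma dep1 [Nontrivial H] (h : PtLoc Φ) {x q : ℝ} (hq : ∀ g, Φ (sm g 1) x = g q • 1)
    (f : C₀(ℝ, H →L[ℂ] H)) {r : ℝ} (hr : 0 < r) (hf : ∀ y, |y - q| < 2 * r → f y = 0) :
    Φ f x = 0 := by
  let g := bump q r hr
  have hgq : g q = 1 := bump_one _ _ _ _ (by simp [hr.le])
  have key : ∀ c : ℂ, ‖f‖ + ‖Φ f‖ < ‖c‖ → ∃ t : ℝ, Φ f x = (c * t) • 1 := by
    intro c hc
    obtain ⟨p, τ, hp⟩ := h (f + c • sm g 1) x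
    simp only [map_add, map_smul, ZeroAtInftyContinuousMap.add_apply,
      ZeroAtInftyContinuousMap.smul_apply, hq, hgq, one_smul, sm_apply, map_one] at hp
    by_cases hpq : |p - q| < 2 * r
    · rw [hf p hpq, map_zero, zero_add] at hp
      obtain ⟨t, ht, -, -⟩ := bump_eq q r hr p
      refine ⟨t - 1, ?_⟩
      change g p = t at ht
      rw [ht] at hp
      rw [eq_sub_of_add_eq hp, smul_smul, ← sub_smul]
      congr 1
      push_cast
      ring
    · exfalso
      rw [show g p = 0 from bump_zero _ _ _ _ (not_lt.mp hpq), zero_smul, smul_zero, add_zero] at hp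
      obtain ⟨s, hs⟩ := spectrum.nonempty (f p)
      have h1 : ‖s‖ ≤ ‖f‖ := (spectrum.norm_le_norm_of_mem hs).trans (c0_le f p)
      rw [← AlgEquiv.spectrum_eq τ, ← hp, ← Algebra.algebraMap_eq_smul_one] at hs
      have h2 : s - c ∈ spectrum ℂ (Φ f x) := by
        rw [spectrum.mem_iff] at hs ⊢
        convert hs using 2
        rw [map_sub]; abel
      have h3 : ‖s - c‖ ≤ ‖Φ f‖ := (spectrum.norm_le_norm_of_mem h2).trans (c0_le _ x)
      have h4 : ‖c‖ ≤ ‖s‖ + ‖s - c‖ := by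
        have := norm_sub_le s (s - c)
        simpa using this
      linarith
  set N : ℝ := ‖f‖ + ‖Φ f‖ + 1 with hN
  have hN0 : 0 < N := by positivity
  obtain ⟨t, ht⟩ := key N (by rw [Complex.norm_real, Real.norm_eq_abs, abs_of_pos hN0]; linarith)
  obtain ⟨t', ht'⟩ := key (Complex.I * N) (by
    rw [norm_mul, Complex.norm_I, Complex.norm_real, Real.norm_eq_abs, abs_of_pos hN0]; linarith)
  have h1 := scalar_inj (ht.symm.trans ht')
  have h2 := congrArg Complex.re h1
  simp at h2
  rw [ht]
  rcases h2 with h2 | h2 <;> simp [h2]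

lemma dep2 [Nontrivial H] (h : PtLoc Φ) {x q : ℝ} (hq : ∀ g, Φ (sm g 1) x = g q • 1)
    (f : C₀(ℝ, H →L[ℂ] H)) (hf : f q = 0) : Φ f x = 0 := by
  have key : ∀ ε > 0, ‖Φ f x‖ ≤ ‖Φ‖ * ε := by
    intro ε hε
    have hc : Continuous fun y => f y := f.continuous
    obtain ⟨δ, hδ, hd⟩ := Metric.continuousAt_iff.mp (hc.continuousAt (x := q)) ε hε
    let g := bump q (δ / 2) (half_pos hδ)
    have h1 : Φ (f - sm g 1 * f) x = 0 := by
      apply dep1 h hq _ (r := δ / 4) (by positivity)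
      intro y hy
      have : g y = 1 := bump_one _ _ _ _ (by linarith)
      simp [this]
    rw [map_sub, ZeroAtInftyContinuousMap.sub_apply, sub_eq_zero] at h1
    rw [h1]
    refine (c0_le _ x).trans ((Φ.le_opNorm _).trans ?_)
    gcongr
    apply c0_norm_le_s8 _ hε.le
    intro y
    obtain ⟨t, ht, ht0, ht1⟩ := bump_eq q (δ / 2) (half_pos hδ) y
    change g y = t at ht
    by_cases hy : |y - q| < δ
    · have h2 := hd (x := y) (by rwa [Real.dist_eq])
      rw [hf, dist_zero_right] at h2
      simp only [ZeroAtInftyContinuousMap.mul_apply, sm_apply, ht, smul_mul_assoc, one_mul, norm_smul,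
        Complex.norm_real, Real.norm_eq_abs, abs_of_nonneg ht0]
      nlinarith [norm_nonneg (f y)]
    · have : g y = 0 := bump_zero _ _ _ _ (by linarith)
      simp [this, hε.le]
  rw [← norm_le_zero_iff]
  by_contra! hpos
  have h1 := key (‖Φ f x‖ / (2 * (‖Φ‖ + 1))) (by positivity)
  have h2 : ‖Φ‖ * (‖Φ f x‖ / (2 * (‖Φ‖ + 1))) ≤ ‖Φ f x‖ / 2 := by
    rw [← mul_div_assoc, div_le_div_iff₀ (by positivity) (by positivity)]
    nlinarith [norm_nonneg Φ]
  linarith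

lemma fiber [Nontrivial H] (h : PtLoc Φ) {x q : ℝ} (hq : ∀ g, Φ (sm g 1) x = g q • 1) :
    ∃ Ψ : (H →L[ℂ] H) →L[ℂ] (H →L[ℂ] H), IsLoc Ψ ∧ (∀ f, Φ f x = Ψ (f q)) ∧
      ∀ T, ‖Ψ T‖ ≤ ‖Φ‖ * ‖T‖ := by
  let G := bump q 1 one_pos
  have hG : G q = 1 := bump_one _ _ _ _ (by simp)
  have hdep : ∀ f f' : C₀(ℝ, H →L[ℂ] H), f q = f' q → Φ f x = Φ f' x := by
    intro f f' hff
    have h1 := dep2 h hq (f - f') (by simp [hff])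
    simpa [sub_eq_zero] using h1
  let Ψ0 : (H →L[ℂ] H) →ₗ[ℂ] (H →L[ℂ] H) :=
    { toFun := fun T => Φ (sm G T) x
      map_add' := fun T T' => by
        rw [← ZeroAtInftyContinuousMap.add_apply, ← map_add]
        exact hdep _ _ (by simp)
      map_smul' := fun c T => by
        simp only [RingHom.id_apply]
        rw [← ZeroAtInftyContinuousMap.smul_apply, ← map_smul]
        exact hdep _ _ (by simp only [ZeroAtInftyContinuousMap.smul_apply, sm_apply, hG, one_smul]) }
  have hb : ∀ T, ‖Ψ0 T‖ ≤ ‖Φ‖ * ‖T‖ := by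
    intro T
    refine (c0_le _ x).trans ((Φ.le_opNorm _).trans ?_)
    gcongr
    apply c0_norm_le_s8 _ (norm_nonneg _)
    intro y
    obtain ⟨t, ht, ht0, ht1⟩ := bump_eq q 1 one_pos y
    change G y = t at ht
    simp only [sm_apply, ht, norm_smul, Complex.norm_real, Real.norm_eq_abs, abs_of_nonneg ht0]
    nlinarith [norm_nonneg T]
  let Ψ := Ψ0.mkContinuous ‖Φ‖ hb
  have hΨ : ∀ T, Ψ T = Φ (sm G T) x := fun T => rfl
  refine ⟨Ψ, ?_, fun f => hdep _ _ (by simp [hG]), hb⟩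
  have hloc : ∀ T, ∃ (c : ℝ) (τ : (H →L[ℂ] H) ≃ₐ[ℂ] (H →L[ℂ] H)),
      0 ≤ c ∧ c ≤ 1 ∧ Ψ T = (c : ℂ) • τ T := by
    intro T
    obtain ⟨p, τ, hp⟩ := h (sm G T) x
    obtain ⟨t, ht, ht0, ht1⟩ := bump_eq q 1 one_pos p
    change G p = t at ht
    exact ⟨t, τ, ht0, ht1, by rw [hΨ, hp, sm_apply, map_smul, ht]⟩
  have h1 : Ψ 1 = 1 := by rw [hΨ, hq, hG, one_smul]
  intro T
  obtain ⟨s, hs, hmax⟩ := (spectrum.isCompact (𝕜 := ℂ) T).exists_isMaxOn (spectrum.nonempty T)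
    Complex.continuous_re.continuousOn
  let S : H →L[ℂ] H := T + algebraMap ℂ _ (1 - s)
  have hS1 : ∀ z, z ∈ spectrum ℂ S → z.re ≤ 1 := by
    intro z hz
    have : z - (1 - s) ∈ spectrum ℂ T := by
      rw [spectrum.mem_iff] at hz ⊢
      convert hz using 2
      simp only [S, map_sub]; abel
    have := hmax this
    simp at this
    linarith
  have hS2 : ¬ IsUnit (S - 1) := by
    rw [spectrum.mem_iff, ← IsUnit.neg_iff] at hs
    convert hs using 2
    simp only [S, map_sub, map_one]; abel
  obtain ⟨c, τ, hc0, hc1, hc⟩ := hloc S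
  obtain ⟨c', τ', -, -, hc'⟩ := hloc (S - 1)
  have h2 : (1 : ℂ) ∈ spectrum ℂ (Ψ S) := by
    rw [spectrum.mem_iff, ← IsUnit.neg_iff, neg_sub, map_one, ← h1, ← map_sub, hc']
    intro hu
    apply hS2
    have hc'0 : (c' : ℂ) ≠ 0 := by
      intro h0
      rw [h0, zero_smul] at hu
      exact not_isUnit_zero hu
    rw [← MulEquiv.isUnit_map τ']
    exact (isUnit_smul_iff (Units.mk0 _ hc'0) (τ' (S - 1))).mp hu
  have hc0' : (c : ℂ) ≠ 0 := by
    intro h0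
    rw [hc, h0, zero_smul, spectrum.zero_eq] at h2
    simp at h2
  have h3 : (c : ℂ)⁻¹ ∈ spectrum ℂ S := by
    rw [hc] at h2
    rw [← AlgEquiv.spectrum_eq τ]
    refine (spectrum.smul_mem_smul_iff (r := Units.mk0 _ hc0')).mp ?_
    have h6 : Units.mk0 (c : ℂ) hc0' • (c : ℂ)⁻¹ = 1 := by
      rw [Units.smul_def, Units.val_mk0, smul_eq_mul, mul_inv_cancel₀ hc0']
    rw [h6]
    exact h2
  have h4 := hS1 _ h3
  rw [← Complex.ofReal_inv, Complex.ofReal_re] at h4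
  have hcne : c ≠ 0 := by exact_mod_cast hc0'
  have hcpos : 0 < c := lt_of_le_of_ne hc0 hcne.symm
  have h5 : c = 1 := by
    rw [inv_le_one₀ hcpos] at h4
    linarith
  refine ⟨τ, ?_⟩
  rw [h5, Complex.ofReal_one, one_smul] at hc
  simp only [S, map_add, AlgEquiv.commutes] at hc
  rw [Algebra.algebraMap_eq_smul_one, map_smul, h1] at hc
  exact add_right_cancel hc

end P5

section P6
open Filter Topology
variable {H : Type*} [NormedAddCommGroup H] [InnerProductSpace ℂ H]

/-- conjugation `T ↦ A⁻¹ T A` -/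
noncomputable def conjInv (A : H ≃L[ℂ] H) (T : H →L[ℂ] H) : H →L[ℂ] H :=
  (A.symm : H →L[ℂ] H) ∘L T ∘L (A : H →L[ℂ] H)

lemma conjInv_apply (A : H ≃L[ℂ] H) (T : H →L[ℂ] H) (v : H) :
    conjInv A T v = A.symm (T (A v)) := rfl

lemma conjInv_sub (A : H ≃L[ℂ] H) (T T' : H →L[ℂ] H) :
    conjInv A (T - T') = conjInv A T - conjInv A T' := by
  ext v; simp [conjInv_apply]

lemma conjInv_bound {A : H ≃L[ℂ] H} {Ψ : (H →L[ℂ] H) →L[ℂ] (H →L[ℂ] H)} {C : ℝ}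
    (hA : ∀ T v, Ψ T (A v) = A (T v)) (hC : ∀ T, ‖Ψ T‖ ≤ C * ‖T‖) (hC0 : 0 ≤ C)
    (T : H →L[ℂ] H) : ‖conjInv A T‖ ≤ C * ‖T‖ := by
  apply ContinuousLinearMap.opNorm_le_bound _ (by positivity)
  intro v
  obtain ⟨f, hf1, hf⟩ := exists_dual_vector'' ℂ (conjInv A T v)
  let f' : H →L[ℂ] ℂ := f ∘L (A.symm : H →L[ℂ] H)
  have h1 : Ψ (rk v f) = rk (A v) f' := by
    ext w
    obtain ⟨u, rfl⟩ := A.surjective w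
    rw [hA]
    simp [f']
  have h2 : ‖f'‖ * ‖A v‖ ≤ C * (‖f‖ * ‖v‖) := by
    have := hC (rk v f)
    rw [h1] at this
    simpa only [rk, ContinuousLinearMap.norm_smulRight_apply] using this
  have h3 : ‖conjInv A T v‖ = ‖f' (T (A v))‖ := by
    have : f' (T (A v)) = f (conjInv A T v) := rfl
    rw [this, hf]
    simp
  rw [h3]
  calc ‖f' (T (A v))‖ ≤ ‖f'‖ * (‖T‖ * ‖A v‖) :=
        (f'.le_opNorm _).trans (by gcongr; exact T.le_opNorm _)
    _ = (‖f'‖ * ‖A v‖) * ‖T‖ := by ring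
    _ ≤ (C * (‖f‖ * ‖v‖)) * ‖T‖ := by gcongr
    _ ≤ (C * (1 * ‖v‖)) * ‖T‖ := by gcongr
    _ = C * ‖T‖ * ‖v‖ := by ring

end P6

theorem aut_reflexive_suspension_BH
    {H : Type*} [NormedAddCommGroup H] [InnerProductSpace ℂ H] [CompleteSpace H]
    [TopologicalSpace.SeparableSpace H] (hH : ¬ FiniteDimensional ℂ H)
    (Φ : C₀(ℝ, H →L[ℂ] H) →L[ℂ] C₀(ℝ, H →L[ℂ] H))
    (hΦ : ∀ f : C₀(ℝ, H →L[ℂ] H), ∃ S : C₀(ℝ, H →L[ℂ] H) → C₀(ℝ, H →L[ℂ] H),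
      IsAlgebraAutomorphism S ∧ Φ f = S f) :
    IsAlgebraAutomorphism (⇑Φ) := by
  have hnt : Nontrivial H := by
    by_contra hn
    rw [not_nontrivial_iff_subsingleton] at hn
    exact hH inferInstance
  obtain ⟨e, he⟩ := exists_ne (0 : H)
  obtain ⟨k, hek⟩ := exists_fun he
  have hloc : ∀ f, ∃ φ : ℝ ≃ₜ ℝ, ∀ x, ∃ τ : (H →L[ℂ] H) ≃ₐ[ℂ] (H →L[ℂ] H),
      Φ f x = τ (f (φ x)) := by
    intro f
    obtain ⟨S, hS, hf⟩ := hΦ f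
    obtain ⟨φ, hφ⟩ := structS hS hek
    refine ⟨φ, fun x => ?_⟩
    obtain ⟨τ, hτ⟩ := hφ x
    exact ⟨τ, by rw [hf, hτ]⟩
  have hpt : PtLoc Φ := by
    intro f x
    obtain ⟨φ, hφ⟩ := hloc f
    exact ⟨φ x, hφ x⟩
  obtain ⟨φ, hφ⟩ := hloc (sm hh 1)
  have hq : ∀ x g, Φ (sm g 1) x = g (φ x) • 1 := by
    intro x g
    obtain ⟨q, hq⟩ := scalar_part hpt x
    obtain ⟨τ, hτ⟩ := hφ x
    rw [hq hh, sm_apply, map_smul, map_one] at hτ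
    have : q = φ x := hh_inj (scalar_inj hτ)
    rw [hq, this]
  have hfib : ∀ x, ∃ (Ψ : (H →L[ℂ] H) →L[ℂ] (H →L[ℂ] H)) (A : H ≃L[ℂ] H),
      (∀ f, Φ f x = Ψ (f (φ x))) ∧ (∀ T, ‖Ψ T‖ ≤ ‖Φ‖ * ‖T‖) ∧ ∀ T v, Ψ T (A v) = A (T v) := by
    intro x
    obtain ⟨Ψ, h1, h2, h3⟩ := fiber hpt (hq x)
    obtain ⟨A, hA⟩ := local_aut hH h1
    exact ⟨Ψ, A, h2, h3, hA⟩
  choose Ψ A hΨ hb hA using hfib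
  have hmul : ∀ x T T', Ψ x (T * T') = Ψ x T * Ψ x T' := by
    intro x T T'
    ext w
    obtain ⟨v, rfl⟩ := (A x).surjective w
    simp [hA]
  have hinv : ∀ x T, conjInv (A x) (Ψ x T) = T := by
    intro x T
    ext v
    simp [conjInv_apply, hA]
  have hinv' : ∀ x T, Ψ x (conjInv (A x) T) = T := by
    intro x T
    ext w
    obtain ⟨v, rfl⟩ := (A x).surjective w
    simp [conjInv_apply, hA]
  have hcb : ∀ x T, ‖conjInv (A x) T‖ ≤ ‖Φ‖ * ‖T‖ := fun x T =>
    conjInv_bound (hA x) (hb x) (ContinuousLinearMap.opNorm_nonneg Φ) T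
  have hΨc : ∀ T y, ContinuousAt (fun x => Ψ x T) y := by
    intro T y
    let f := sm (bump (φ y) 1 one_pos) T
    have hc : Continuous fun x => Φ f x := (Φ f).continuous
    refine hc.continuousAt.congr ?_
    have h1 : ∀ᶠ x in nhds y, dist (φ x) (φ y) < 1 :=
      (φ.continuous.continuousAt (x := y)).eventually (Metric.ball_mem_nhds _ one_pos)
    filter_upwards [h1] with x hx
    rw [hΨ]
    congr 1
    rw [Real.dist_eq] at hx
    simp only [f, sm_apply]
    rw [bump_one _ _ _ _ hx.le, one_smul]
  refine ⟨⟨map_add Φ, map_smul Φ⟩, ?_, ?_, ?_⟩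
  · intro f g
    ext1 x
    rw [ZeroAtInftyContinuousMap.mul_apply, hΨ, hΨ, hΨ, ZeroAtInftyContinuousMap.mul_apply, hmul]
  · intro f g hfg
    ext1 y
    obtain ⟨x, rfl⟩ := φ.surjective y
    rw [← hinv x (f (φ x)), ← hΨ, hfg, hΨ, hinv]
  · intro g
    have hgc : Continuous fun x => g x := g.continuous
    have hcont : Continuous fun x => conjInv (A x) (g x) := by
      rw [continuous_iff_continuousAt]
      intro y
      rw [ContinuousAt, tendsto_iff_norm_sub_tendsto_zero]
      have h0 : Filter.Tendsto
          (fun x => ‖Φ‖ * ‖g x - Ψ x (conjInv (A y) (g y))‖) (nhds y) (nhds 0) := by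
        have h1 : ContinuousAt (fun x => ‖Φ‖ * ‖g x - Ψ x (conjInv (A y) (g y))‖) y :=
          continuousAt_const.mul ((hgc.continuousAt.sub (hΨc _ y)).norm)
        have h2 := h1.tendsto
        simpa only [hinv', sub_self, norm_zero, mul_zero] using h2
      refine squeeze_zero (fun _ => norm_nonneg _) (fun x => ?_) h0
      calc ‖conjInv (A x) (g x) - conjInv (A y) (g y)‖
          = ‖conjInv (A x) (g x - Ψ x (conjInv (A y) (g y)))‖ := by rw [conjInv_sub, hinv]
        _ ≤ _ := hcb x _
    have hzero : Filter.Tendsto (fun x => conjInv (A x) (g x)) (Filter.cocompact ℝ) (nhds 0) := by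
      have h1 : Filter.Tendsto (fun x => ‖Φ‖ * ‖g x‖) (Filter.cocompact ℝ) (nhds 0) := by
        have h2 : Filter.Tendsto (fun x => g x) (Filter.cocompact ℝ) (nhds 0) := g.zero_at_infty'
        have := (h2.norm).const_mul ‖Φ‖
        simpa using this
      exact squeeze_zero_norm (fun x => hcb x _) h1
    let f : C₀(ℝ, H →L[ℂ] H) :=
      { toFun := fun y => conjInv (A (φ.symm y)) (g (φ.symm y))
        continuous_toFun := hcont.comp φ.symm.continuous
        zero_at_infty' := hzero.comp φ.symm.isClosedEmbedding.tendsto_cocompact }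
    refine ⟨f, ?_⟩
    ext1 x
    have hfx : f (φ x) = conjInv (A x) (g x) := by
      change conjInv (A (φ.symm (φ x))) (g (φ.symm (φ x))) = _
      rw [φ.symm_apply_apply]
    rw [hΨ, hfx, hinv']
end
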